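/- arXiv:2307.04752 — 3 statements merged into one kernel-verified Lean document; each statement's English description precedes it below -/
import Mathlib

section
/- Let E₁ be the elliptic curve over ℚ with Weierstrass equation y² + y = x³ − x (LMFDB label 37.a1). Then the Mordell–Weil group E₁(ℚ) is isomorphic to ℤ as an abelian group; in particular E₁ has Mordell–Weil rank 1 and trivial rational torsion. -/
/-- The elliptic curve `E₁ : y² + y = x³ - x` over `ℚ` (LMFDB label 37.a1). -/
def E₁ : WeierstrassCurve ℚ := ⟨0, 0, 1, -1, 0⟩

open Polynomial NumberField Module

/-- The polynomial `X³ - 4X + 2`, whose roots are twice the `x`-coordinates of the points of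
order two on `E₁`. -/
noncomputable def cubic : ℚ[X] := X ^ 3 - C 4 * X + C 2

lemma cubic_monic : cubic.Monic := by unfold cubic; monicity!

lemma cubic_natDegree : cubic.natDegree = 3 := by unfold cubic; compute_degree!

lemma cubic_eval (t : ℚ) : cubic.eval t = t ^ 3 - 4 * t + 2 := by simp [cubic]

lemma cubic_eval₂ {S : Type*} [CommRing S] (i : ℚ →+* S) (t : S) :
    cubic.eval₂ i t = t ^ 3 - 4 * t + 2 := by
  simp [cubic, eval₂_add, eval₂_sub, eval₂_pow, eval₂_mul]
  rw [map_ofNat, map_ofNat]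

lemma rat_cubic_ne_zero (t : ℚ) : t ^ 3 - 4 * t + 2 ≠ 0 := by
  intro h
  have hd : (t.den : ℚ) ≠ 0 := by exact_mod_cast t.den_nz
  have h1 : t.num ^ 3 - 4 * t.num * (t.den : ℤ) ^ 2 + 2 * (t.den : ℤ) ^ 3 = 0 := by
    have : ((t.num : ℚ) / t.den) ^ 3 - 4 * (t.num / t.den) + 2 = 0 := by rwa [Rat.num_div_den]
    field_simp at this
    have h2 : (t.num : ℚ) ^ 3 - 4 * t.num * (t.den : ℚ) ^ 2 + 2 * (t.den : ℚ) ^ 3 = 0 := by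
      linear_combination this
    exact_mod_cast h2
  have hn : (2 : ℤ) ∣ t.num :=
    Int.prime_two.dvd_of_dvd_pow (n := 3)
      ⟨2 * t.num * t.den ^ 2 - t.den ^ 3, by linear_combination h1⟩
  have hm : (2 : ℤ) ∣ t.den := by
    obtain ⟨k, hk⟩ := hn
    rw [hk] at h1
    exact Int.prime_two.dvd_of_dvd_pow (n := 3)
      ⟨2 * k * t.den ^ 2 - 2 * k ^ 3, by linarith⟩
  have := Int.dvd_gcd hn hm
  rw [Int.gcd_eq_natAbs, Int.natAbs_natCast, t.reduced] at this
  norm_num at this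

lemma cubic_irreducible : Irreducible cubic :=
  irreducible_of_degree_le_three_of_not_isRoot (by simp [cubic_natDegree])
    fun t ht ↦ rat_cubic_ne_zero t (by rw [← cubic_eval]; exact ht)

instance : Fact (Irreducible cubic) := ⟨cubic_irreducible⟩

/-- The cubic field `ℚ[X] / (X³ - 4X + 2)`. -/
def CubicField : Type := AdjoinRoot cubic

namespace CubicField

noncomputable instance : Field CubicField := inferInstanceAs (Field (AdjoinRoot cubic))

noncomputable instance : Algebra ℚ CubicField := inferInstanceAs (Algebra ℚ (AdjoinRoot cubic))

/-- The power basis of the cubic field generated by the class of `X`. -/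
noncomputable def powerBasis : PowerBasis ℚ CubicField :=
  AdjoinRoot.powerBasis cubic_monic.ne_zero

lemma powerBasis_dim : powerBasis.dim = 3 :=
  (AdjoinRoot.powerBasis_dim cubic_monic.ne_zero).trans cubic_natDegree

/-- The class of `X` in the cubic field. -/
noncomputable def root : CubicField := powerBasis.gen

/-- The basis `1, γ, γ²` of the cubic field. -/
noncomputable def basis : Basis (Fin 3) ℚ CubicField :=
  powerBasis.basis.reindex (finCongr powerBasis_dim)

lemma basis_apply (i : Fin 3) : basis i = root ^ (i : ℕ) := by
  simp [basis, root]

instance : CharZero CubicField := algebraRat.charZero _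

instance : NumberField CubicField where
  to_finiteDimensional := Module.Basis.finiteDimensional_of_finite basis

lemma finrank_eq : finrank ℚ CubicField = 3 := by
  simpa using finrank_eq_card_basis basis

lemma root_pow : root ^ 3 = 4 * root - 2 := by
  have h : root ^ 3 - 4 * root + 2 = 0 :=
    (cubic_eval₂ (AdjoinRoot.of cubic) (AdjoinRoot.root cubic)).symm.trans
      (AdjoinRoot.eval₂_root cubic)
  linear_combination h

lemma root_isIntegral : IsIntegral ℤ root := by
  refine ⟨X ^ 3 - C 4 * X + C 2, by monicity!, ?_⟩
  simp [root_pow]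

/-- The root of the cubic as an algebraic integer. -/
noncomputable def γ : 𝓞 CubicField := ⟨root, root_isIntegral⟩

lemma coe_γ : (γ : CubicField) = root := rfl

lemma γ_pow : γ ^ 3 = 4 * γ - 2 := by
  apply RingOfIntegers.coe_injective
  rw [map_pow, map_sub, map_mul]
  rw [map_ofNat, map_ofNat]
  exact root_pow

lemma exists_coords (z : CubicField) : ∃ p q r : ℚ, z = p + q * root + r * root ^ 2 := by
  refine ⟨basis.repr z 0, basis.repr z 1, basis.repr z 2, ?_⟩
  conv_lhs => rw [← basis.sum_repr z]
  simp [Fin.sum_univ_three, basis_apply, Algebra.smul_def]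

lemma coords_eq_zero {p q r : ℚ} (h : (p : CubicField) + q * root + r * root ^ 2 = 0) :
    p = 0 ∧ q = 0 ∧ r = 0 := by
  have := Fintype.linearIndependent_iff.mp basis.linearIndependent ![p, q, r]
    (by simpa [Fin.sum_univ_three, basis_apply, Algebra.smul_def] using h)
  exact ⟨this 0, this 1, this 2⟩

lemma leftMulMatrix_root :
    Algebra.leftMulMatrix basis root = !![0, 0, -2; 1, 0, 4; 0, 1, 0] := by
  have key (j : Fin 3) (a b c : ℚ) (h : root * basis j = a + b * root + c * root ^ 2) (i : Fin 3) :
      basis.repr (root * basis j) i = ![a, b, c] i := by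
    have : root * basis j = ∑ k, ![a, b, c] k • basis k := by
      rw [h]; simp [Fin.sum_univ_three, basis_apply, Algebra.smul_def]
    rw [this, Basis.repr_sum_self]
  ext i j
  rw [Algebra.leftMulMatrix_eq_repr_mul]
  fin_cases j
  · rw [key _ 0 1 0 (by simp [basis_apply])]; fin_cases i <;> simp
  · rw [key _ 0 0 1 (by simp [basis_apply, pow_two])]; fin_cases i <;> simp
  · rw [key _ (-2) 4 0 (by simp [basis_apply]; linear_combination root_pow)]
    fin_cases i <;> simp

lemma leftMulMatrix_coords (p q r : ℚ) :
    Algebra.leftMulMatrix basis (p + q * root + r * root ^ 2) =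
      !![p, -2 * r, -2 * q; q, p + 4 * r, 4 * q - 2 * r; r, q, p + 4 * r] := by
  have (a : ℚ) : (a : CubicField) = algebraMap ℚ _ a := rfl
  simp only [map_add, map_mul, map_pow, leftMulMatrix_root, this, AlgHom.commutes]
  ext i j
  fin_cases i <;> fin_cases j <;>
    simp [pow_two, Algebra.algebraMap_eq_smul_one] <;> ring

lemma norm_coords (p q r : ℚ) :
    Algebra.norm ℚ ((p : CubicField) + q * root + r * root ^ 2) =
      p ^ 3 + 8 * p ^ 2 * r - 4 * p * q ^ 2 + 6 * p * q * r + 16 * p * r ^ 2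
        - 2 * q ^ 3 + 8 * q * r ^ 2 + 4 * r ^ 3 := by
  rw [Algebra.norm_eq_matrix_det basis, leftMulMatrix_coords, Matrix.det_fin_three]
  simp
  ring

lemma trace_coords (p q r : ℚ) :
    Algebra.trace ℚ CubicField (p + q * root + r * root ^ 2) = 3 * p + 8 * r := by
  rw [Algebra.trace_eq_matrix_trace basis, leftMulMatrix_coords, Matrix.trace_fin_three]
  simp
  ring

lemma trace_int_coords (p q r : ℤ) :
    Algebra.trace ℤ (𝓞 CubicField) (p + q * γ + r * γ ^ 2) = 3 * p + 8 * r := by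
  have h := trace_coords p q r
  have h2 := Algebra.coe_trace_int
    ((p : 𝓞 CubicField) + (q : 𝓞 CubicField) * γ + (r : 𝓞 CubicField) * γ ^ 2)
  have h3 : algebraMap (𝓞 CubicField) CubicField
      ((p : 𝓞 CubicField) + (q : 𝓞 CubicField) * γ + (r : 𝓞 CubicField) * γ ^ 2) =
      ((p : ℚ) : CubicField) + (q : ℚ) * root + (r : ℚ) * root ^ 2 := by
    simp [coe_γ]
  have h4 := h2.trans ((congrArg (Algebra.trace ℚ CubicField) h3).trans h)
  exact_mod_cast h4

lemma norm_int_coords (p q r : ℤ) :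
    Algebra.norm ℤ ((p : 𝓞 CubicField) + q * γ + r * γ ^ 2) =
      p ^ 3 + 8 * p ^ 2 * r - 4 * p * q ^ 2 + 6 * p * q * r + 16 * p * r ^ 2
        - 2 * q ^ 3 + 8 * q * r ^ 2 + 4 * r ^ 3 := by
  have h := norm_coords p q r
  have h2 := Algebra.coe_norm_int
    ((p : 𝓞 CubicField) + (q : 𝓞 CubicField) * γ + (r : 𝓞 CubicField) * γ ^ 2)
  have h3 : algebraMap (𝓞 CubicField) CubicField
      ((p : 𝓞 CubicField) + (q : 𝓞 CubicField) * γ + (r : 𝓞 CubicField) * γ ^ 2) =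
      ((p : ℚ) : CubicField) + (q : ℚ) * root + (r : ℚ) * root ^ 2 := by
    simp [coe_γ]
  have h4 := h2.trans ((congrArg (Algebra.norm ℚ) h3).trans h)
  exact_mod_cast h4

lemma discr_pow_γ : Algebra.discr ℤ (fun i : Fin 3 ↦ γ ^ (i : ℕ)) = 148 := by
  have key (x : 𝓞 CubicField) (p q r : ℤ) (h : x = p + q * γ + r * γ ^ 2) :
      Algebra.trace ℤ (𝓞 CubicField) x = 3 * p + 8 * r := by rw [h, trace_int_coords]
  have hM : Algebra.traceMatrix ℤ (fun i : Fin 3 ↦ γ ^ (i : ℕ)) =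
      !![3, 0, 8; 0, 8, -6; 8, -6, 32] := by
    have h0 := key 1 1 0 0 (by simp)
    have h1 := key γ 0 1 0 (by simp)
    have h2 := key (γ ^ 2) 0 0 1 (by simp)
    have h3 := key (γ ^ 3) (-2) 4 0 (by push_cast; linear_combination γ_pow)
    have h4 := key (γ ^ 4) 0 (-2) 4 (by push_cast; linear_combination γ * γ_pow)
    ext i j
    rw [Algebra.traceMatrix_apply, Algebra.traceForm_apply, ← pow_add]
    fin_cases i <;> fin_cases j <;> simp [h0, h1, h2, h3, h4]
  rw [Algebra.discr_def, hM, Matrix.det_fin_three]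
  simp

lemma abs_discr_le : |discr CubicField| ≤ 148 := by
  have hfin : finrank ℤ (𝓞 CubicField) = 3 := (RingOfIntegers.rank _).trans finrank_eq
  let b : Basis (Fin 3) ℤ (𝓞 CubicField) := finBasisOfFinrankEq ℤ _ hfin
  have h := Algebra.discr_of_matrix_vecMul (A := ℤ) b (b.toMatrix fun i : Fin 3 ↦ γ ^ (i : ℕ))
  rw [discr_eq_discr CubicField b] at h
  have hv : Matrix.vecMul b ((b.toMatrix fun i : Fin 3 ↦ γ ^ (i : ℕ)).map
      (algebraMap ℤ (𝓞 CubicField))) = fun i : Fin 3 ↦ γ ^ (i : ℕ) := by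
    ext i
    conv_rhs => rw [← b.sum_repr (γ ^ (i : ℕ))]
    simp [Matrix.vecMul, dotProduct, Basis.toMatrix_apply, mul_comm]
  rw [hv, discr_pow_γ] at h
  set P := (b.toMatrix fun i : Fin 3 ↦ γ ^ (i : ℕ)).det
  have hP : P ≠ 0 := by rintro h0; simp [h0] at h
  have hP1 : 1 ≤ P ^ 2 := by have := sq_pos_of_ne_zero hP; omega
  calc |discr CubicField| = 1 * |discr CubicField| := (one_mul _).symm
    _ ≤ P ^ 2 * |discr CubicField| := by gcongr
    _ = |P ^ 2 * discr CubicField| := by rw [abs_mul, abs_of_nonneg (sq_nonneg P)]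
    _ = 148 := by rw [← h]; norm_num

/-- The real embedding of the cubic field attached to a real root of the cubic. -/
noncomputable def realEmbedding (ρ : ℝ) (h : ρ ^ 3 - 4 * ρ + 2 = 0) : CubicField →+* ℝ :=
  AdjoinRoot.lift (algebraMap ℚ ℝ) ρ ((cubic_eval₂ _ _).trans h)

lemma realEmbedding_root (ρ : ℝ) (h : ρ ^ 3 - 4 * ρ + 2 = 0) : realEmbedding ρ h root = ρ :=
  AdjoinRoot.lift_root _

lemma exists_real_root {a b : ℝ} (hab : a ≤ b)
    (h : (a ^ 3 - 4 * a + 2) * (b ^ 3 - 4 * b + 2) < 0) :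
    ∃ σ : CubicField →+* ℝ, a < σ root ∧ σ root < b := by
  have hc : ContinuousOn (fun t : ℝ ↦ t ^ 3 - 4 * t + 2) (Set.uIcc a b) := by fun_prop
  have h0 : (0 : ℝ) ∈ Set.uIcc (a ^ 3 - 4 * a + 2) (b ^ 3 - 4 * b + 2) := by
    rw [Set.mem_uIcc]
    rcases mul_neg_iff.mp h with h | h
    · exact .inr ⟨h.2.le, h.1.le⟩
    · exact .inl ⟨h.1.le, h.2.le⟩
  obtain ⟨ρ, hρ, hρ0⟩ := intermediate_value_uIcc hc h0
  rw [Set.uIcc_of_le hab] at hρ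
  refine ⟨realEmbedding ρ hρ0, ?_⟩
  rw [realEmbedding_root]
  refine ⟨lt_of_le_of_ne hρ.1 ?_, lt_of_le_of_ne hρ.2 ?_⟩ <;> rintro rfl <;> simp [hρ0] at h

lemma exists_real_embeddings : ∃ σ₁ σ₂ σ₃ : CubicField →+* ℝ,
    (1 / 2 < σ₁ root ∧ σ₁ root < 1) ∧ (3 / 2 < σ₂ root ∧ σ₂ root < 2) ∧
      (-3 < σ₃ root ∧ σ₃ root < -2) := by
  obtain ⟨σ₁, h₁⟩ := exists_real_root (a := 1 / 2) (b := 1) (by norm_num) (by norm_num)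
  obtain ⟨σ₂, h₂⟩ := exists_real_root (a := 3 / 2) (b := 2) (by norm_num) (by norm_num)
  obtain ⟨σ₃, h₃⟩ := exists_real_root (a := -3) (b := -2) (by norm_num) (by norm_num)
  exact ⟨σ₁, σ₂, σ₃, h₁, h₂, h₃⟩

lemma nrComplexPlaces_eq_zero : InfinitePlace.nrComplexPlaces CubicField = 0 := by
  classical
  obtain ⟨σ₁, σ₂, -, h₁, h₂, -⟩ := exists_real_embeddings
  have hreal (σ : CubicField →+* ℝ) :
      ComplexEmbedding.IsReal (Complex.ofRealHom.comp σ) := by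
    ext x; simp
  have hne : σ₁ ≠ σ₂ := by rintro rfl; linarith
  have hcard : 1 < InfinitePlace.nrRealPlaces CubicField := by
    rw [← InfinitePlace.card_real_embeddings, Fintype.one_lt_card_iff]
    refine ⟨⟨_, hreal σ₁⟩, ⟨_, hreal σ₂⟩, fun h ↦ hne ?_⟩
    ext x
    simpa using congrArg (fun φ ↦ φ.1 x) h
  have := InfinitePlace.card_add_two_mul_card_eq_rank CubicField
  rw [finrank_eq] at this
  omega

lemma card_infinitePlace : Fintype.card (InfinitePlace CubicField) = 3 := by
  have h1 := InfinitePlace.card_eq_nrRealPlaces_add_nrComplexPlaces CubicField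
  have h2 := InfinitePlace.card_add_two_mul_card_eq_rank CubicField
  rw [nrComplexPlaces_eq_zero] at h1 h2
  rw [finrank_eq] at h2
  omega

lemma norm_γ : Algebra.norm ℤ γ = -2 := by
  simpa using norm_int_coords 0 1 0

lemma isPrime_span_γ : (Ideal.span {γ}).IsPrime := by
  apply Ideal.isPrime_of_irreducible_absNorm
  rw [Ideal.absNorm_span_singleton, norm_γ]
  exact Nat.prime_two

instance : IsPrincipalIdealRing (𝓞 CubicField) := by
  apply RingOfIntegers.isPrincipalIdealRing_of_isPrincipal_of_norm_le
  intro I hI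
  have hlt : Ideal.absNorm (I : Ideal (𝓞 CubicField)) < 3 := by
    have hs : √|(discr CubicField : ℝ)| < 13 := by
      rw [Real.sqrt_lt' (by norm_num)]
      have : |(discr CubicField : ℝ)| ≤ 148 := by exact_mod_cast abs_discr_le
      linarith
    rw [nrComplexPlaces_eq_zero, finrank_eq] at hI
    norm_num [Nat.factorial] at hI
    have : (Ideal.absNorm (I : Ideal (𝓞 CubicField)) : ℝ) < 3 := by linarith
    exact_mod_cast this
  have hpos := Ideal.absNorm_pos_of_nonZeroDivisors I
  obtain h | h : Ideal.absNorm (I : Ideal (𝓞 CubicField)) = 1 ∨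
    Ideal.absNorm (I : Ideal (𝓞 CubicField)) = 2 := by omega
  · rw [Ideal.absNorm_eq_one_iff.mp h]
    infer_instance
  · have hp : (I : Ideal (𝓞 CubicField)).IsPrime :=
      Ideal.isPrime_of_irreducible_absNorm (h ▸ Nat.prime_two)
    have h2 : (2 : 𝓞 CubicField) ∈ (I : Ideal (𝓞 CubicField)) := by
      simpa [h] using Ideal.absNorm_mem (I : Ideal (𝓞 CubicField))
    have hγ : γ ∈ (I : Ideal (𝓞 CubicField)) := by
      refine hp.mem_of_pow_mem 3 ?_
      rw [γ_pow, show 4 * γ - 2 = (2 * γ - 1) * 2 by ring]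
      exact Ideal.mul_mem_left _ _ h2
    have hmax : (Ideal.span {γ}).IsMaximal :=
      isPrime_span_γ.isMaximal (by simpa using fun h0 ↦ by simpa [h0] using norm_γ)
    rw [← hmax.eq_of_le hp.ne_top (by simpa [Ideal.span_le] using hγ)]
    exact ⟨γ, rfl⟩

lemma rank_units : Units.rank CubicField = 2 := by
  rw [Units.rank, card_infinitePlace]

/-- The sign of a unit of the ring of integers under a real embedding. -/
noncomputable def unitSign (σ : CubicField →+* ℝ) (u : (𝓞 CubicField)ˣ) : SignType :=
  SignType.sign (σ u)

lemma unitSign_mul (σ : CubicField →+* ℝ) (u v : (𝓞 CubicField)ˣ) :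
    unitSign σ (u * v) = unitSign σ u * unitSign σ v := by
  simp [unitSign, sign_mul]

lemma unitSign_one (σ : CubicField →+* ℝ) : unitSign σ 1 = 1 := by
  simp [unitSign]

lemma unitSign_pow (σ : CubicField →+* ℝ) (u : (𝓞 CubicField)ˣ) (n : ℕ) :
    unitSign σ (u ^ n) = unitSign σ u ^ n := by
  induction n with
  | zero => simp [unitSign_one]
  | succ n ih => rw [pow_succ, pow_succ, unitSign_mul, ih]

lemma unitSign_sq (σ : CubicField →+* ℝ) (u : (𝓞 CubicField)ˣ) : unitSign σ (u ^ 2) = 1 := by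
  have : (0 : ℝ) < σ u ^ 2 := sq_pos_of_ne_zero (by simp)
  simpa [unitSign] using sign_pos this

/-- The unit `γ - 1`. -/
noncomputable def unit₁ : (𝓞 CubicField)ˣ :=
  .mkOfMulEqOne (γ - 1) (γ ^ 2 + γ - 3) (by linear_combination γ_pow)

/-- The unit `2γ - 1`. -/
noncomputable def unit₂ : (𝓞 CubicField)ˣ :=
  .mkOfMulEqOne (2 * γ - 1) (15 - 2 * γ - 4 * γ ^ 2) (by linear_combination -8 * γ_pow)

/-- The parity of the exponents of a unit with respect to a fundamental system of units. -/
lemma exists_unit_parity :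
    ∃ par : (𝓞 CubicField)ˣ → Bool × (Fin (Units.rank CubicField) → ZMod 2),
    ∀ u v, par u = par v → ∃ w, u = v * w ^ 2 := by
  classical
  choose ζe hζe _ using Units.exist_unique_eq_mul_prod CubicField
  refine ⟨fun u ↦ (decide ((ζe u).1 = 1), fun i ↦ ((ζe u).2 i : ZMod 2)), fun u v h ↦ ?_⟩
  obtain ⟨h1, h2⟩ := Prod.mk.inj h
  have hodd : Odd (finrank ℚ CubicField) := by rw [finrank_eq]; decide
  have hζ : (ζe u).1 = (ζe v).1 := by
    rw [decide_eq_decide] at h1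
    by_cases hu : (ζe u).1 = 1
    · rw [hu, h1.mp hu]
    · have key (ζ : Units.torsion CubicField) (h : ζ ≠ 1) : (ζ : (𝓞 CubicField)ˣ) = -1 :=
        (Units.torsion_eq_one_or_neg_one_of_odd_finrank hodd ζ).resolve_left
          fun h' ↦ h (Subtype.ext h')
      exact Subtype.ext ((key _ hu).trans (key _ (mt h1.mpr hu)).symm)
  have he (i) : ∃ f : ℤ, (ζe u).2 i = (ζe v).2 i + 2 * f := by
    obtain ⟨f, hf⟩ := (ZMod.intCast_eq_intCast_iff_dvd_sub _ _ 2).mp (congrFun h2 i).symm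
    exact ⟨f, by push_cast at hf; linarith⟩
  choose f hf using he
  refine ⟨∏ i, Units.fundSystem CubicField i ^ f i, ?_⟩
  rw [hζe u, hζe v, hζ, mul_assoc, ← Finset.prod_pow, ← Finset.prod_mul_distrib]
  congr 2
  ext1 i
  rw [hf, zpow_add, mul_comm 2, zpow_mul, zpow_ofNat]

lemma unit_isSquare {σ₁ σ₂ σ₃ : CubicField →+* ℝ} (h₁ : 1 / 2 < σ₁ root ∧ σ₁ root < 1)
    (h₂ : 3 / 2 < σ₂ root ∧ σ₂ root < 2) (h₃ : -3 < σ₃ root ∧ σ₃ root < -2)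
    (u : (𝓞 CubicField)ˣ) (hu₁ : 0 < σ₁ u) (hu₂ : 0 < σ₂ u) (hu₃ : 0 < σ₃ u) :
    ∃ w, u = w ^ 2 := by
  obtain ⟨par, hpar⟩ := exists_unit_parity
  let E (x : Fin 2 × Fin 2 × Fin 2) : (𝓞 CubicField)ˣ :=
    (-1) ^ (x.1 : ℕ) * unit₁ ^ (x.2.1 : ℕ) * unit₂ ^ (x.2.2 : ℕ)
  have hpos {σ : CubicField →+* ℝ} {u : (𝓞 CubicField)ˣ} (h : 0 < σ u) : unitSign σ u = 1 :=
    sign_pos h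
  have hneg {σ : CubicField →+* ℝ} {u : (𝓞 CubicField)ˣ} (h : σ u < 0) : unitSign σ u = -1 :=
    sign_neg h
  have hm (σ : CubicField →+* ℝ) : unitSign σ (-1) = -1 := hneg (by simp)
  have e₁ (σ : CubicField →+* ℝ) : σ unit₁ = σ root - 1 := by simp [unit₁, coe_γ]
  have e₂ (σ : CubicField →+* ℝ) : σ unit₂ = 2 * σ root - 1 := by
    simp [unit₂, coe_γ]
    rw [map_ofNat, map_ofNat]
    simp
  have a₁ : unitSign σ₁ unit₁ = -1 := hneg (by rw [e₁]; linarith)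
  have a₂ : unitSign σ₂ unit₁ = 1 := hpos (by rw [e₁]; linarith)
  have a₃ : unitSign σ₃ unit₁ = -1 := hneg (by rw [e₁]; linarith)
  have b₁ : unitSign σ₁ unit₂ = 1 := hpos (by rw [e₂]; linarith)
  have b₂ : unitSign σ₂ unit₂ = 1 := hpos (by rw [e₂]; linarith)
  have b₃ : unitSign σ₃ unit₂ = -1 := hneg (by rw [e₂]; linarith)
  let s (u : (𝓞 CubicField)ˣ) := (unitSign σ₁ u, unitSign σ₂ u, unitSign σ₃ u)
  have hs (x) : s (E x) = ((-1) ^ (x.1 : ℕ) * (-1) ^ (x.2.1 : ℕ), (-1) ^ (x.1 : ℕ),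
      (-1) ^ (x.1 : ℕ) * (-1) ^ (x.2.1 : ℕ) * (-1) ^ (x.2.2 : ℕ)) := by
    simp [s, E, unitSign_mul, unitSign_pow, hm, a₁, a₂, a₃, b₁, b₂, b₃]
  have hsw (v w) : s (v * w ^ 2) = s v := by simp [s, unitSign_mul, unitSign_sq]
  have hinj : Function.Injective (par ∘ E) := by
    intro x y hxy
    obtain ⟨w, hw⟩ := hpar _ _ hxy
    have : s (E x) = s (E y) := by rw [hw, hsw]
    rw [hs, hs] at this
    clear hxy hw
    revert x y
    decide
  have hbij := (Fintype.bijective_iff_injective_and_card (par ∘ E)).mpr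
    ⟨hinj, by simp [rank_units]⟩
  obtain ⟨x, hx⟩ := hbij.2 (par u)
  obtain ⟨w, hw⟩ := hpar _ _ hx.symm
  have h1 : s u = (1, 1, 1) := by simp only [s, hpos hu₁, hpos hu₂, hpos hu₃]
  rw [hw, hsw, hs] at h1
  have hx0 : x = (0, 0, 0) := by
    clear hx hw
    revert x
    decide
  refine ⟨w, ?_⟩
  rw [hw, hx0]
  simp [E]

lemma _root_.exists_squarefree_mul_sq {R : Type*} [CommRing R] [IsDomain R] [WfDvdMonoid R]
    {x : R} (hx : x ≠ 0) : ∃ r s : R, Squarefree r ∧ x = r * s ^ 2 := by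
  induction x using (wellFounded_dvdNotUnit (α := R)).induction with
  | _ x ih =>
    by_cases hsq : Squarefree x
    · exact ⟨x, 1, hsq, by simp⟩
    · simp only [Squarefree, not_forall] at hsq
      obtain ⟨t, ⟨y, rfl⟩, ht⟩ := hsq
      have hy : y ≠ 0 := right_ne_zero_of_mul hx
      obtain ⟨r, s, hr, rfl⟩ := ih y
        ⟨hy, t * t, fun h ↦ ht (isUnit_of_mul_isUnit_left h), mul_comm _ _⟩ hy
      exact ⟨r, s * t, hr, by ring⟩

lemma norm_descent (a e : ℤ) : Algebra.norm ℤ (γ ^ 2 * (a : 𝓞 CubicField) -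
    (2 * γ - 1) * (e : 𝓞 CubicField)) = 4 * a ^ 3 - 4 * a * e ^ 2 + e ^ 3 := by
  have h := norm_int_coords e (-2 * e) a
  rw [show γ ^ 2 * (a : 𝓞 CubicField) - (2 * γ - 1) * (e : 𝓞 CubicField) =
    (e : 𝓞 CubicField) + ((-2 * e : ℤ) : 𝓞 CubicField) * γ + a * γ ^ 2 by push_cast; ring, h]
  ring

lemma exists_eq_unit_mul_sq {a e b : ℤ} (hae : IsCoprime a e) (hb : b ≠ 0)
    (h : b ^ 2 = 4 * a ^ 3 - 4 * a * e ^ 2 + e ^ 3) :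
    ∃ (u : (𝓞 CubicField)ˣ) (s : 𝓞 CubicField),
      γ ^ 2 * (a : 𝓞 CubicField) - (2 * γ - 1) * (e : 𝓞 CubicField) = u * s ^ 2 := by
  have hN := norm_descent a e
  rw [← h] at hN
  set a' : 𝓞 CubicField := (a : 𝓞 CubicField) with ha'
  set e' : 𝓞 CubicField := (e : 𝓞 CubicField) with he'
  set b' : 𝓞 CubicField := (b : 𝓞 CubicField) with hb'
  have hb0 : b' ≠ 0 := Int.cast_ne_zero.mpr hb
  have h' : b' ^ 2 = 4 * a' ^ 3 - 4 * a' * e' ^ 2 + e' ^ 3 := by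
    simp only [ha', he', hb']; exact_mod_cast congrArg (Int.cast : ℤ → 𝓞 CubicField) h
  set D := γ ^ 2 * a' - (2 * γ - 1) * e' with hD
  set C := (4 - γ ^ 2) ^ 2 * a' ^ 2 + (4 - γ ^ 2) * a' * e' + (1 - (4 - γ ^ 2) ^ 2) * e' ^ 2 with hC
  have hDC : D * C = b' ^ 2 := by
    rw [h', hD, hC]
    linear_combination (4 * a' * e' ^ 2 + 4 * a' * e' ^ 2 * γ - a' * e' ^ 2 * γ ^ 3 +
      8 * a' ^ 2 * e' - 2 * a' ^ 2 * e' * γ ^ 2 - 2 * a' ^ 3 - 4 * a' ^ 3 * γ + a' ^ 3 * γ ^ 3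
      - 8 * e' ^ 3 - e' ^ 3 * γ + 2 * e' ^ 3 * γ ^ 2) * γ_pow
  have hD0 : D ≠ 0 := left_ne_zero_of_mul (hDC ▸ pow_ne_zero 2 hb0)
  obtain ⟨r, s, hr, hrs⟩ := exists_squarefree_mul_sq hD0
  have hs0 : s ≠ 0 := by rintro rfl; simp [hrs] at hD0
  have hsb : s ∣ b' := by
    rw [← IsIntegrallyClosed.pow_dvd_pow_iff (n := 2) two_ne_zero]
    exact ⟨r * C, by rw [← hDC, hrs]; ring⟩
  obtain ⟨c, hc⟩ := hsb
  have hrC : r * C = c ^ 2 := by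
    apply mul_left_cancel₀ (pow_ne_zero 2 hs0)
    rw [← mul_pow, ← hc, ← hDC, hrs]; ring
  obtain ⟨f, hf⟩ := (hr.dvd_pow_iff_dvd two_ne_zero).mp ⟨C, hrC.symm⟩
  have hdC : r ∣ C := ⟨f ^ 2, mul_left_cancel₀ hr.ne_zero (by rw [hrC, hf]; ring)⟩
  have hdD : r ∣ D := ⟨s ^ 2, hrs⟩
  have hdE : r ∣ (4 - γ ^ 2) * a' - e' := by
    refine (dvd_mul_of_dvd_left hdD (15 - 2 * γ - 4 * γ ^ 2)).trans (dvd_of_eq ?_)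
    rw [hD]
    linear_combination (-2 * a' - 4 * a' * γ + 8 * e') * γ_pow
  have hda : r ∣ (4 - γ ^ 2) ^ 2 * (3 - (4 - γ ^ 2) ^ 2) * a' ^ 2 := by
    have := hdC.add (dvd_mul_of_dvd_left hdE
      ((1 - (4 - γ ^ 2) ^ 2) * (e' + (4 - γ ^ 2) * a') + (4 - γ ^ 2) * a'))
    refine this.trans (dvd_of_eq ?_)
    rw [hC]; ring
  have hcop : IsCoprime r a' := by
    have h1 : IsCoprime a' e' := hae.map (Int.castRingHom (𝓞 CubicField))
    have h2 : IsCoprime a' ((4 - γ ^ 2) * a' - e') := by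
      have := h1.neg_right.add_mul_left_right (4 - γ ^ 2)
      rwa [show -e' + a' * (4 - γ ^ 2) = (4 - γ ^ 2) * a' - e' by ring] at this
    exact (h2.of_isCoprime_of_dvd_right hdE).symm
  have hdγ : r ∣ 8 - 3 * γ - 2 * γ ^ 2 := by
    have h1 := hcop.pow_right (n := 2) |>.dvd_of_dvd_mul_right hda
    have h2 : 8 - 3 * γ - 2 * γ ^ 2 = -γ * (3 - (4 - γ ^ 2) ^ 2) := by
      linear_combination (4 - γ ^ 2) * γ_pow
    have h3 : (4 - γ ^ 2) * (2 * γ - 1) = γ ^ 2 := by linear_combination -2 * γ_pow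
    have h4 : r ∣ (8 - 3 * γ - 2 * γ ^ 2) ^ 4 := by
      refine (dvd_mul_of_dvd_left h1 ((2 * γ - 1) ^ 2 * (3 - (4 - γ ^ 2) ^ 2) ^ 3)).trans
        (dvd_of_eq ?_)
      rw [h2]
      linear_combination (3 - (4 - γ ^ 2) ^ 2) ^ 4 *
        ((4 - γ ^ 2) * (2 * γ - 1) + γ ^ 2) * h3
    exact (hr.dvd_pow_iff_dvd four_ne_zero).mp h4
  have hNr : Algebra.norm ℤ r ∣ 74 := by
    have h1 := map_dvd (Algebra.norm ℤ) hdγ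
    have h2 := norm_int_coords 8 (-3) (-2)
    rw [show ((8 : ℤ) : 𝓞 CubicField) + ((-3 : ℤ) : 𝓞 CubicField) * γ +
      ((-2 : ℤ) : 𝓞 CubicField) * γ ^ 2 = 8 - 3 * γ - 2 * γ ^ 2 by push_cast; ring] at h2
    rw [h2] at h1
    norm_num at h1
    exact h1
  have hNrs : Algebra.norm ℤ r * Algebra.norm ℤ s ^ 2 = b ^ 2 := by
    rw [← map_pow, ← map_mul, ← hrs, hN]
  have hNs0 : Algebra.norm ℤ s ≠ 0 := Algebra.norm_ne_zero_iff.mpr hs0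
  obtain ⟨k, hk⟩ : Algebra.norm ℤ s ∣ b :=
    (Int.pow_dvd_pow_iff two_ne_zero).mp ⟨_, by rw [← hNrs]; ring⟩
  have hNk : Algebra.norm ℤ r = k ^ 2 := by
    apply mul_right_cancel₀ (pow_ne_zero 2 hNs0)
    rw [hNrs, hk]; ring
  have hk1 : IsUnit k := by
    rw [hNk] at hNr
    have h1 : k.natAbs ^ 2 ∣ 74 := by
      rw [← Int.natAbs_pow]
      exact Int.natAbs_dvd_natAbs.mpr hNr
    have h2 : k.natAbs < 9 := by
      by_contra! h
      nlinarith [Nat.le_of_dvd (by norm_num) h1]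
    rw [Int.isUnit_iff_natAbs_eq]
    generalize k.natAbs = m at h1 h2
    interval_cases m <;> revert h1 <;> decide
  have hru : IsUnit r := by
    rw [NumberField.isUnit_iff_norm, RingOfIntegers.coe_norm, ← Algebra.coe_norm_int, hNk]
    rcases Int.isUnit_iff.mp hk1 with rfl | rfl <;> simp
  exact ⟨hru.unit, s, hrs⟩

lemma isSquare_sub_half_root {x : ℚ} {d a b : ℤ} (hd : d ≠ 0) (hx : x = a / (d : ℚ) ^ 2)
    (had : IsCoprime a d) (hb : b ≠ 0)
    (h : b ^ 2 = 4 * a ^ 3 - 4 * a * (d ^ 2) ^ 2 + (d ^ 2) ^ 3) (hx2 : 1 / 2 < x) :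
    ∃ z : CubicField, (x : CubicField) - root / 2 = z ^ 2 := by
  obtain ⟨σ₁, σ₂, σ₃, h₁, h₂, h₃⟩ := exists_real_embeddings
  obtain ⟨u, s, hus⟩ := exists_eq_unit_mul_sq (had.pow_right (n := 2)) hb h
  have hdQ : (d : ℚ) ≠ 0 := by exact_mod_cast hd
  have hdK : (d : CubicField) ≠ 0 := by exact_mod_cast hd
  have hroot : root ≠ 0 := by
    intro h0
    have := root_pow
    rw [h0] at this
    norm_num at this
  have hD : root ^ 2 * d ^ 2 * (x - root / 2) = (u : CubicField) * (s : CubicField) ^ 2 := by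
    have h1 := congrArg (algebraMap (𝓞 CubicField) CubicField) hus
    simp only [map_sub, map_mul, map_pow, map_intCast, coe_γ, map_one] at h1
    rw [map_ofNat] at h1
    rw [← h1, hx]
    push_cast
    field_simp
    linear_combination -(d : CubicField) ^ 2 * root_pow
  have hx3 : 0 < 4 * x ^ 3 - 4 * x + 1 := by
    have : 4 * x ^ 3 - 4 * x + 1 = (b / d ^ 3) ^ 2 := by
      have hQ : (b : ℚ) ^ 2 = 4 * a ^ 3 - 4 * a * (d ^ 2) ^ 2 + (d ^ 2) ^ 3 := by exact_mod_cast h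
      rw [hx]
      field_simp
      linear_combination -hQ
    rw [this]
    have : (b : ℚ) ≠ 0 := by exact_mod_cast hb
    positivity
  have hpos {σ : CubicField →+* ℝ} (hσ : σ root < 2 * x) : 0 < σ u := by
    have h1 := congrArg σ hD
    simp only [map_mul, map_sub, map_pow, map_div₀, map_intCast, map_ratCast] at h1
    rw [map_ofNat] at h1
    have h2 : σ root ≠ 0 := by simpa using hroot
    have h3 : (d : ℝ) ≠ 0 := by exact_mod_cast hd
    have h4 : 0 < σ root ^ 2 * (d : ℝ) ^ 2 * (x - σ root / 2) := by
      have : 0 < x - σ root / 2 := by linarith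
      positivity
    rw [h1] at h4
    exact pos_of_mul_pos_left h4 (sq_nonneg _)
  have hxR : (1 / 2 : ℝ) < x := by
    have := (Rat.cast_lt (K := ℝ)).mpr hx2
    push_cast at this
    exact this
  have hx3R : 0 < 4 * (x : ℝ) ^ 3 - 4 * x + 1 := by exact_mod_cast hx3
  have hσ₂ : σ₂ root ^ 3 - 4 * σ₂ root + 2 = 0 := by
    have := congrArg σ₂ root_pow
    simp only [map_pow, map_sub, map_mul] at this
    rw [map_ofNat, map_ofNat] at this
    linarith
  have hσ₂x : σ₂ root < 2 * x := by
    by_contra! hle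
    nlinarith [mul_nonneg (sub_nonneg.mpr hle)
      (show 0 ≤ (2 * x : ℝ) ^ 2 + 2 * x * σ₂ root + σ₂ root ^ 2 - 4 by nlinarith)]
  obtain ⟨w, rfl⟩ := unit_isSquare h₁ h₂ h₃ u (hpos (by linarith)) (hpos hσ₂x)
    (hpos (by linarith))
  refine ⟨(w : CubicField) * s / (root * d), ?_⟩
  field_simp
  push_cast at hD
  linear_combination 2 * hD

/-- Two-descent: a point `(x, y)` of `Y² = 4X³ - 4X + 1` with `x - root / 2` a square in the cubic
field lies on a line through `-2Q` tangent to the curve at a rational point `Q`. -/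
lemma exists_tangent {x : ℚ} {z : CubicField} (h : (x : CubicField) - root / 2 = z ^ 2) :
    ∃ m n t : ℚ, ∀ T : ℚ,
      4 * T ^ 3 - 4 * T + 1 = (m * T + n) ^ 2 + 4 * (T - x) * (T - t) ^ 2 := by
  obtain ⟨p, q, r, rfl⟩ := exists_coords z
  have hr : r ≠ 0 := by
    rintro rfl
    have := coords_eq_zero (p := p ^ 2 - x) (q := 2 * p * q + 1 / 2) (r := q ^ 2) (by
      push_cast at h ⊢
      linear_combination -h)
    obtain rfl : q = 0 := by simpa using this.2.2
    norm_num at this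
  set M := -p * q - 2 * r ^ 2 with hM
  set N := p * r - q ^ 2 + 4 * r ^ 2 with hN
  obtain ⟨c₀, c₁, c₂⟩ := coords_eq_zero (p := M ^ 2 - x * q ^ 2 - r ^ 2)
    (q := 2 * M * N + 2 * x * q * r + q ^ 2 / 2 + 2 * r ^ 2) (r := N ^ 2 - x * r ^ 2 - q * r) (by
      have hz : ((p : CubicField) + q * root + r * root ^ 2) * (r * root - q) = M + N * root := by
        rw [hM, hN]
        push_cast
        linear_combination (r : CubicField) ^ 2 * root_pow
      push_cast
      linear_combination (-(M + N * root : CubicField) - ((p : CubicField) + q * root +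
        r * root ^ 2) * (r * root - q)) * hz - ((r : CubicField) * root - q) ^ 2 * h -
        (r : CubicField) ^ 2 / 2 * root_pow)
  refine ⟨2 * N / r, M / r, q / (2 * r), fun T ↦ ?_⟩
  field_simp
  linear_combination -4 * c₀ - 8 * T * c₁ - 16 * T ^ 2 * c₂

end CubicField

/-- The naive height of a rational number. -/
def ratHeight (x : ℚ) : ℕ := max x.num.natAbs x.den

lemma num_le_ratHeight (x : ℚ) : |x.num| ≤ ratHeight x := by
  rw [Int.abs_eq_natAbs]
  exact_mod_cast le_max_left _ _

lemma den_le_ratHeight (x : ℚ) : (x.den : ℤ) ≤ ratHeight x := by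
  exact_mod_cast le_max_right _ _

lemma exists_num_den_mul {x : ℚ} {n m : ℤ} (hm : m ≠ 0) (h : x * m = n) :
    ∃ k : ℤ, k ≠ 0 ∧ n = x.num * k ∧ m = x.den * k := by
  have hd : (x.den : ℚ) ≠ 0 := by exact_mod_cast x.den_nz
  have h1 : x.num * m = n * x.den := by
    have h2 := x.num_div_den
    rw [← h2] at h
    field_simp at h
    have h3 : (x.num : ℚ) * m = n * x.den := by linear_combination h
    exact_mod_cast h3
  have hcop : IsCoprime (x.den : ℤ) x.num := (Rat.isCoprime_num_den x).symm
  obtain ⟨k, hk⟩ := hcop.dvd_of_dvd_mul_left (Dvd.intro_left n h1.symm)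
  refine ⟨k, by rintro rfl; simp [hk] at hm, ?_, hk⟩
  apply mul_right_cancel₀ (show (x.den : ℤ) ≠ 0 by exact_mod_cast x.den_nz)
  rw [← h1, hk]; ring

lemma ratHeight_le {x : ℚ} {n m : ℤ} {B : ℕ} (hm : m ≠ 0) (h : x * m = n) (hnB : |n| ≤ B)
    (hmB : |m| ≤ B) : ratHeight x ≤ B := by
  obtain ⟨k, hk, rfl, rfl⟩ := exists_num_den_mul hm h
  have hk1 : 1 ≤ |k| := Int.one_le_abs hk
  rw [abs_mul] at hnB hmB
  have h1 : |x.num| ≤ B := le_trans (le_mul_of_one_le_right (abs_nonneg _) hk1) hnB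
  have h2 : |(x.den : ℤ)| ≤ B := le_trans (le_mul_of_one_le_right (abs_nonneg _) hk1) hmB
  rw [Int.abs_eq_natAbs] at h1 h2
  exact max_le (by exact_mod_cast h1) (by exact_mod_cast h2)

lemma ratHeight_double {x x' : ℚ} (h0 : 4 * x ^ 3 - 4 * x + 1 ≠ 0)
    (h : x' * (4 * x ^ 3 - 4 * x + 1) = x ^ 4 + 2 * x ^ 2 - 2 * x + 1) :
    ratHeight x ^ 4 ≤ 171 * ratHeight x' := by
  set a := x.num with ha
  set D := (x.den : ℤ) with hD
  have hD0 : D ≠ 0 := by simp [hD]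
  have hDQ : (D : ℚ) ≠ 0 := by exact_mod_cast hD0
  have hx : x = a / D := by simp [ha, hD, x.num_div_den]
  set N := a ^ 4 + 2 * a ^ 2 * D ^ 2 - 2 * a * D ^ 3 + D ^ 4 with hN
  set M := D * (4 * a ^ 3 - 4 * a * D ^ 2 + D ^ 3) with hM
  have hMQ : (M : ℚ) = D ^ 4 * (4 * x ^ 3 - 4 * x + 1) := by
    rw [hM, hx]; push_cast; field_simp
  have hNQ : (N : ℚ) = D ^ 4 * (x ^ 4 + 2 * x ^ 2 - 2 * x + 1) := by
    rw [hN, hx]; push_cast; field_simp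
  have hM0 : M ≠ 0 := by
    have : (M : ℚ) ≠ 0 := by rw [hMQ]; exact mul_ne_zero (pow_ne_zero 4 hDQ) h0
    exact_mod_cast this
  have hbez₁ : (-48 * a ^ 2 * D + 64 * D ^ 3) * N + (12 * a ^ 3 + 20 * a * D ^ 2 - 27 * D ^ 3) * M =
      37 * D ^ 7 := by rw [hN, hM]; ring
  have hbez₂ : (37 * a ^ 3 + 4 * a ^ 2 * D - 26 * a * D ^ 2 + 6 * D ^ 3) * N +
      (-a ^ 3 - 12 * a ^ 2 * D + 14 * a * D ^ 2 - 6 * D ^ 3) * M = 37 * a ^ 7 := by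
    rw [hN, hM]; ring
  obtain ⟨k, -, hNk, hMk⟩ := exists_num_den_mul (x := x') (n := N) (m := M) hM0
    (by rw [hMQ, hNQ, ← h]; ring)
  have hkN : k ∣ N := Dvd.intro_left _ hNk.symm
  have hkM : k ∣ M := Dvd.intro_left _ hMk.symm
  have hkdvd : k ∣ 37 := by
    have h1 : k ∣ 37 * D ^ 7 := by
      rw [← hbez₁]
      exact dvd_add (hkN.mul_left _) (hkM.mul_left _)
    have h2 : k ∣ 37 * a ^ 7 := by
      rw [← hbez₂]
      exact dvd_add (hkN.mul_left _) (hkM.mul_left _)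
    obtain ⟨u, v, huv⟩ := (Rat.isCoprime_num_den x).pow (m := 7) (n := 7)
    have : (37 : ℤ) = u * (37 * a ^ 7) + v * (37 * D ^ 7) := by linear_combination -37 * huv
    rw [this]
    exact dvd_add (h2.mul_left _) (h1.mul_left _)
  have hk37 : |k| ≤ 37 := Int.le_of_dvd (by norm_num) ((abs_dvd _ _).mpr hkdvd)
  set H : ℤ := (ratHeight x : ℤ) with hH
  set H' : ℤ := (ratHeight x' : ℤ) with hH'
  have haH : |a| ≤ H := num_le_ratHeight x
  have hDH : |D| ≤ H := by rw [abs_of_nonneg (by simp [hD])]; exact den_le_ratHeight x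
  have hH0 : 0 < H := lt_of_lt_of_le (abs_pos.mpr hD0) hDH
  have hNH : |N| ≤ 37 * H' := by
    rw [hNk, abs_mul, mul_comm]
    exact mul_le_mul hk37 (num_le_ratHeight x') (abs_nonneg _) (by norm_num)
  have hMH : |M| ≤ 37 * H' := by
    rw [hMk, abs_mul, mul_comm, Nat.abs_cast]
    exact mul_le_mul hk37 (den_le_ratHeight x') (by positivity) (by norm_num)
  have mon (i j : ℕ) (c : ℤ) (hij : i + j = 3) : |c * (a ^ i * D ^ j)| ≤ |c| * H ^ 3 := by
    rw [abs_mul, abs_mul, abs_pow, abs_pow, ← hij, pow_add]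
    gcongr
  have hcub (c₃ c₂ c₁ c₀ : ℤ) : |c₃ * a ^ 3 + c₂ * a ^ 2 * D + c₁ * a * D ^ 2 + c₀ * D ^ 3| ≤
      (|c₃| + |c₂| + |c₁| + |c₀|) * H ^ 3 := by
    have e₁ := mon 3 0 c₃ rfl
    have e₂ := mon 2 1 c₂ rfl
    have e₃ := mon 1 2 c₁ rfl
    have e₄ := mon 0 3 c₀ rfl
    rw [abs_le] at *
    constructor <;> nlinarith
  have key (A B C : ℤ) (s t : ℤ) (hA : |A| ≤ s * H ^ 3) (hB : |B| ≤ t * H ^ 3)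
      (hC : A * N + B * M = C) (hst : s + t ≤ 171) : |C| ≤ 171 * H ^ 3 * (37 * H') := by
    calc |C| ≤ |A| * |N| + |B| * |M| := by
          rw [← hC, ← abs_mul, ← abs_mul]; exact abs_add_le _ _
      _ ≤ (s * H ^ 3) * (37 * H') + (t * H ^ 3) * (37 * H') := by
          gcongr
          · exact (abs_nonneg _).trans hA
          · exact (abs_nonneg _).trans hB
      _ = (s + t) * (H ^ 3 * (37 * H')) := by ring
      _ ≤ 171 * (H ^ 3 * (37 * H')) := by gcongr
      _ = _ := by ring
  have hD7 : |37 * D ^ 7| ≤ 171 * H ^ 3 * (37 * H') :=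
    key _ _ _ 112 59 (by simpa using hcub 0 (-48) 0 64)
      (by simpa [sub_eq_add_neg] using hcub 12 0 20 (-27)) hbez₁ (by norm_num)
  have ha7 : |37 * a ^ 7| ≤ 171 * H ^ 3 * (37 * H') :=
    key _ _ _ 73 33 (by simpa [sub_eq_add_neg] using hcub 37 4 (-26) 6)
      (by simpa [sub_eq_add_neg] using hcub (-1) (-12) 14 (-6)) hbez₂ (by norm_num)
  have hH7 : H ^ 7 ≤ 171 * H ^ 3 * H' := by
    rw [abs_mul, abs_pow] at hD7 ha7
    norm_num at hD7 ha7
    have : H = |a| ∨ H = |D| := by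
      rw [hH, ha, hD, ratHeight, Nat.abs_cast, Int.abs_eq_natAbs]
      rcases max_choice x.num.natAbs x.den with h | h <;> simp [h]
    rcases this with h | h
    · rw [← h] at ha7; linarith
    · rw [← h] at hD7; linarith
  have : H ^ 4 ≤ 171 * H' := by
    have h3 : 0 < H ^ 3 := by positivity
    nlinarith
  rw [hH, hH'] at this
  exact_mod_cast this

lemma exists_coords_E₁ {x y : ℚ} (h : y ^ 2 + y = x ^ 3 - x) :
    ∃ a d r : ℤ, d ≠ 0 ∧ IsCoprime a d ∧ x.num = a ∧ (x.den : ℤ) = d ^ 2 ∧ x = a / (d : ℚ) ^ 2 ∧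
      y = r / (d : ℚ) ^ 3 ∧ r ^ 2 + r * d ^ 3 = a ^ 3 - a * d ^ 4 := by
  set a := x.num with ha
  set m := (x.den : ℤ) with hm
  set r := y.num with hr
  set q := (y.den : ℤ) with hq
  have hm0 : m ≠ 0 := by simp [hm]
  have hq0 : q ≠ 0 := by simp [hq]
  have hmQ : (m : ℚ) ≠ 0 := by exact_mod_cast hm0
  have hqQ : (q : ℚ) ≠ 0 := by exact_mod_cast hq0
  have hx : x = a / m := by simp [ha, hm, x.num_div_den]
  have hy : y = r / q := by simp [hr, hq, y.num_div_den]
  have hcx : IsCoprime a m := Rat.isCoprime_num_den x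
  have hcy : IsCoprime r q := Rat.isCoprime_num_den y
  have h1 : r * (r + q) * m ^ 3 = a * (a ^ 2 - m ^ 2) * q ^ 2 := by
    rw [hx, hy] at h
    field_simp at h
    have : (r * (r + q) * m ^ 3 : ℚ) = a * (a ^ 2 - m ^ 2) * q ^ 2 := by linear_combination h
    exact_mod_cast this
  have hc1 : IsCoprime (r * (r + q)) (q ^ 2) := by
    refine (IsCoprime.mul_left hcy ?_).pow_right
    simpa using hcy.add_mul_right_left 1
  have hc2 : IsCoprime (a * (a ^ 2 - m ^ 2)) (m ^ 3) := by
    refine (IsCoprime.mul_left hcx ?_).pow_right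
    have := (hcx.pow_left (m := 2)).add_mul_right_left (-m)
    rwa [show a ^ 2 + -m * m = a ^ 2 - m ^ 2 by ring] at this
  have hqm : q ^ 2 = m ^ 3 := by
    apply Int.dvd_antisymm (by positivity) (by simp only [hm]; positivity)
    · exact hc1.symm.dvd_of_dvd_mul_left (Dvd.intro_left _ h1.symm)
    · exact hc2.symm.dvd_of_dvd_mul_left (Dvd.intro_left _ h1)
  obtain ⟨d, hd⟩ : m ∣ q := (Int.pow_dvd_pow_iff two_ne_zero).mp ⟨m, by rw [hqm]; ring⟩
  have hdm : m = d ^ 2 := by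
    apply mul_left_cancel₀ (pow_ne_zero 2 hm0)
    rw [← mul_pow, ← hd, hqm]; ring
  have hd0 : d ≠ 0 := by rintro rfl; simp [hdm] at hm0
  have hqd : q = d ^ 3 := by rw [hd, hdm]; ring
  refine ⟨a, d, r, hd0, ?_, rfl, hdm, ?_, ?_, ?_⟩
  · rw [hdm] at hcx
    exact (IsCoprime.pow_right_iff two_pos).mp hcx
  · rw [hx, hdm]; push_cast; rfl
  · rw [hy, hqd]; push_cast; rfl
  · apply mul_right_cancel₀ (pow_ne_zero 6 hd0)
    rw [hdm, hqd] at h1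
    linear_combination h1

lemma ratHeight_add {x y x' : ℚ} (h : y ^ 2 + y = x ^ 3 - x) (hx : x ≠ 0)
    (h' : x' = (-y - x) / x ^ 2) : ratHeight x' ≤ 3 * ratHeight x ^ 2 := by
  obtain ⟨a, d, r, hd0, -, hnum, hden, hxa, hyr, hr⟩ := exists_coords_E₁ h
  have hdQ : (d : ℚ) ≠ 0 := by exact_mod_cast hd0
  have ha0 : a ≠ 0 := by rintro rfl; simp [hxa] at hx
  have haQ : (a : ℚ) ≠ 0 := by exact_mod_cast ha0
  have haH : |a| ≤ ratHeight x := hnum ▸ num_le_ratHeight x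
  have hdH : d ^ 2 ≤ ratHeight x := hden ▸ den_le_ratHeight x
  refine ratHeight_le (n := -(r * d) - a * d ^ 2) (m := a ^ 2) (pow_ne_zero 2 ha0) ?_ ?_ ?_
  · rw [h', hxa, hyr]; push_cast; field_simp
  all_goals
    push_cast
    generalize (ratHeight x : ℤ) = H at *
  · have hs : (r * d) ^ 2 + (r * d) * (d ^ 2) ^ 2 = d ^ 2 * a ^ 3 - a * (d ^ 2) ^ 3 := by
      linear_combination d ^ 2 * hr
    have he : 0 ≤ d ^ 2 := sq_nonneg d
    generalize r * d = s at *
    generalize d ^ 2 = e at *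
    have hae : |a * e| ≤ H ^ 2 := by
      rw [abs_mul, abs_of_nonneg he, pow_two]
      exact mul_le_mul haH hdH he (by linarith)
    have hae2 : |a ^ 2 - e ^ 2| ≤ 2 * H ^ 2 := by
      have h1 : a ^ 2 ≤ H ^ 2 := sq_le_sq' (by linarith [neg_abs_le a]) (by linarith [le_abs_self a])
      have h2 : e ^ 2 ≤ H ^ 2 := by gcongr
      rw [abs_le]
      constructor <;> nlinarith
    have hprod : |s| ^ 2 ≤ |s| * H ^ 2 + 2 * H ^ 4 := by
      have h1 : s ^ 2 = -s * e ^ 2 + (a * e) * (a ^ 2 - e ^ 2) := by linear_combination hs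
      calc |s| ^ 2 = |-s * e ^ 2 + (a * e) * (a ^ 2 - e ^ 2)| := by
            rw [← h1, abs_pow]
        _ ≤ |s| * e ^ 2 + |a * e| * |a ^ 2 - e ^ 2| := by
            refine (abs_add_le _ _).trans_eq ?_
            rw [abs_mul, abs_mul, abs_neg, abs_of_nonneg (sq_nonneg e)]
        _ ≤ |s| * H ^ 2 + H ^ 2 * (2 * H ^ 2) := by gcongr
        _ = _ := by ring
    have hs2 : |s| ≤ 2 * H ^ 2 := by
      by_contra! hlt
      nlinarith [sq_nonneg H]
    calc |-s - a * e| ≤ |s| + |a * e| := by simpa using abs_sub (-s) (a * e)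
      _ ≤ 3 * H ^ 2 := by linarith
  · rw [abs_pow]
    nlinarith [abs_nonneg a]

open WeierstrassCurve.Affine

lemma nonsingular_E₁_iff {x y : ℚ} : E₁.toAffine.Nonsingular x y ↔ y ^ 2 + y = x ^ 3 - x := by
  rw [← WeierstrassCurve.Affine.equation_iff_nonsingular_of_Δ_ne_zero, equation_iff]
  · norm_num [E₁, sub_eq_add_neg]
  · norm_num [E₁, WeierstrassCurve.Δ, WeierstrassCurve.b₂, WeierstrassCurve.b₄,
      WeierstrassCurve.b₆, WeierstrassCurve.b₈]

/-- The point `(0, 0)` of `E₁`, a generator of the Mordell–Weil group. -/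
def originE₁ : E₁.toAffine.Point := .some 0 0 (nonsingular_E₁_iff.mpr (by norm_num))

lemma disc_ne_zero (x : ℚ) : 4 * x ^ 3 - 4 * x + 1 ≠ 0 := fun h =>
  rat_cubic_ne_zero (2 * x) (by linear_combination 2 * h)

lemma two_mul_add_one_sq {x y : ℚ} (h : E₁.toAffine.Nonsingular x y) :
    (2 * y + 1) ^ 2 = 4 * x ^ 3 - 4 * x + 1 := by
  linear_combination 4 * nonsingular_E₁_iff.mp h

lemma two_mul_add_one_ne_zero {x y : ℚ} (h : E₁.toAffine.Nonsingular x y) : 2 * y + 1 ≠ 0 := by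
  intro h0
  apply disc_ne_zero x
  rw [← two_mul_add_one_sq h, h0]; norm_num

lemma two_nsmul_some {x y : ℚ} (h : E₁.toAffine.Nonsingular x y) :
    ∃ y' h', 2 • Point.some x y h =
      Point.some (((3 * x ^ 2 - 1) / (2 * y + 1)) ^ 2 - 2 * x) y' h' := by
  have hy : y ≠ E₁.toAffine.negY x y := by
    intro h0
    apply two_mul_add_one_ne_zero h
    simp only [negY, E₁] at h0
    linear_combination h0
  have hX : E₁.toAffine.addX x x (E₁.toAffine.slope x x y y) =
      ((3 * x ^ 2 - 1) / (2 * y + 1)) ^ 2 - 2 * x := by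
    rw [slope_of_Y_ne rfl hy]
    simp only [addX, negY, E₁]
    ring
  rw [two_nsmul, Point.add_self_of_Y_ne hy, ← hX]
  exact ⟨_, _, rfl⟩

lemma two_nsmul_X_mul {x y : ℚ} (h : E₁.toAffine.Nonsingular x y) :
    (((3 * x ^ 2 - 1) / (2 * y + 1)) ^ 2 - 2 * x) * (4 * x ^ 3 - 4 * x + 1) =
      x ^ 4 + 2 * x ^ 2 - 2 * x + 1 := by
  have h0 := two_mul_add_one_ne_zero h
  rw [← two_mul_add_one_sq h]
  field_simp
  linear_combination (-2 * x) * two_mul_add_one_sq h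

lemma half_lt_two_nsmul_X {x y : ℚ} (h : E₁.toAffine.Nonsingular x y) :
    1 / 2 < ((3 * x ^ 2 - 1) / (2 * y + 1)) ^ 2 - 2 * x := by
  have h0 := two_mul_add_one_ne_zero h
  have hpos : 0 < 4 * x ^ 3 - 4 * x + 1 := by
    rw [← two_mul_add_one_sq h]; positivity
  have := two_nsmul_X_mul h
  apply lt_of_mul_lt_mul_right _ hpos.le
  rw [this]
  nlinarith [sq_nonneg (x * (x - 1)), sq_nonneg x]

lemma two_nsmul_ne_zero {P : E₁.toAffine.Point} (hP : P ≠ 0) : 2 • P ≠ 0 := by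
  match P, hP with
  | .some x y h, _ =>
    obtain ⟨y', h', e⟩ := two_nsmul_some h
    rw [e]
    exact Point.some_ne_zero h'

lemma originE₁_ne_two_nsmul (Q : E₁.toAffine.Point) : originE₁ ≠ 2 • Q := by
  match Q with
  | .zero =>
    rw [← Point.zero_def, nsmul_zero]
    exact Point.some_ne_zero _
  | .some x y h =>
    obtain ⟨y', h', e⟩ := two_nsmul_some h
    rw [e, originE₁]
    intro h0
    have := half_lt_two_nsmul_X h
    rw [← (Point.some.inj h0).1] at this
    norm_num at this

lemma some_add_originE₁ {x y : ℚ} (h : E₁.toAffine.Nonsingular x y) (hx : x ≠ 0) :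
    ∃ y' h', Point.some x y h + originE₁ = Point.some ((-y - x) / x ^ 2) y' h' := by
  have hX : E₁.toAffine.addX x 0 (E₁.toAffine.slope x 0 y 0) = (-y - x) / x ^ 2 := by
    rw [slope_of_X_ne hx]
    simp only [addX, E₁]
    field_simp
    linear_combination x ^ 2 * nonsingular_E₁_iff.mp h
  rw [originE₁, Point.add_of_X_ne hx, ← hX]
  exact ⟨_, _, rfl⟩

lemma exists_two_nsmul_of_half_lt {x y : ℚ} (h : E₁.toAffine.Nonsingular x y) (hx : 1 / 2 < x) :
    ∃ Q, Point.some x y h = 2 • Q := by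
  obtain ⟨a, d, r, hd, had, -, -, hxa, -, hr⟩ := exists_coords_E₁ (nonsingular_E₁_iff.mp h)
  have hb : (2 * r + d ^ 3) ^ 2 = 4 * a ^ 3 - 4 * a * (d ^ 2) ^ 2 + (d ^ 2) ^ 3 := by
    linear_combination 4 * hr
  have hb0 : 2 * r + d ^ 3 ≠ 0 := by
    intro h0
    apply disc_ne_zero x
    have hdQ : (d : ℚ) ≠ 0 := by exact_mod_cast hd
    rw [h0] at hb
    have hbQ : (0 : ℚ) = 4 * a ^ 3 - 4 * a * (d ^ 2) ^ 2 + (d ^ 2) ^ 3 := by exact_mod_cast hb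
    rw [hxa]
    field_simp
    linear_combination -hbQ
  obtain ⟨z, hz⟩ := CubicField.isSquare_sub_half_root hd hxa had hb0 hb hx
  obtain ⟨m, n, t, hT⟩ := CubicField.exists_tangent hz
  have e0 := hT 0
  have e1 := hT 1
  have e2 := hT (-1)
  have c2 : m ^ 2 = 8 * t + 4 * x := by linear_combination e0 - e1 / 2 - e2 / 2
  have c1 : m * n = -2 - 2 * t ^ 2 - 4 * x * t := by linear_combination (e2 - e1) / 4
  have ht : E₁.toAffine.Nonsingular t ((m * t + n - 1) / 2) :=
    nonsingular_E₁_iff.mpr (by linear_combination -hT t / 4)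
  obtain ⟨y', h', e⟩ := two_nsmul_some ht
  have h0 := two_mul_add_one_ne_zero ht
  have hX : x = ((3 * t ^ 2 - 1) / (2 * ((m * t + n - 1) / 2) + 1)) ^ 2 - 2 * t := by
    have hs : (3 * t ^ 2 - 1) / (2 * ((m * t + n - 1) / 2) + 1) = m / 2 := by
      rw [div_eq_iff h0]
      linear_combination -c1 / 2 - t / 2 * c2
    rw [hs]
    linear_combination -c2 / 4
  rcases Point.X_eq_iff (h₁ := h) (h₂ := h') |>.mp hX with e' | e'
  · exact ⟨_, e'.trans e.symm⟩
  · exact ⟨-Point.some _ _ ht, by rw [e', ← e, neg_nsmul]⟩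

lemma exists_two_nsmul_or (P : E₁.toAffine.Point) :
    ∃ Q, P = 2 • Q ∨ P + originE₁ = 2 • Q := by
  match P with
  | .zero => exact ⟨0, Or.inl (nsmul_zero 2).symm⟩
  | .some x y h =>
    by_cases hx : 1 / 2 < x
    · exact (exists_two_nsmul_of_half_lt h hx).imp fun _ => Or.inl
    by_cases hx0 : x = 0
    · rcases (Point.X_eq_iff (h₁ := h)
        (h₂ := nonsingular_E₁_iff.mpr (by norm_num : (0 : ℚ) ^ 2 + 0 = 0 ^ 3 - 0))).mp hx0 with e | e
      · exact ⟨originE₁, Or.inr (by rw [e, two_nsmul]; rfl)⟩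
      · exact ⟨0, Or.inr (by rw [e, nsmul_zero]; exact neg_add_cancel originE₁)⟩
    obtain ⟨y', h', e⟩ := some_add_originE₁ h hx0
    have hX : 1 / 2 < (-y - x) / x ^ 2 := by
      have hxy := nonsingular_E₁_iff.mp h
      set x' := (-y - x) / x ^ 2 with hx'
      have key : -1 / 2 - (y / x + 1) ^ 2 = 2 * (1 / 2 - x) * (1 / 2 - x') := by
        rw [hx']
        field_simp
        linear_combination (-2 : ℚ) * hxy
      by_contra! hle
      nlinarith [mul_nonneg (sub_nonneg.mpr (not_lt.mp hx)) (sub_nonneg.mpr hle),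
        sq_nonneg (y / x + 1)]
    obtain ⟨Q, hQ⟩ := exists_two_nsmul_of_half_lt h' hX
    exact ⟨Q, Or.inr (e.trans hQ)⟩

/-- The coprime pairs `(a, d)` in the stated range for which `a / d²` is the `x`-coordinate of a
rational point of `E₁`. -/
lemma mem_list_of_isSquare :
    ∀ a ∈ Finset.Icc (-22 : ℤ) 22, ∀ d ∈ Finset.Icc (-4 : ℤ) 4, d ≠ 0 → Int.gcd a d = 1 →
      IsSquare (4 * a ^ 3 - 4 * a * (d ^ 2) ^ 2 + (d ^ 2) ^ 3) →
      (a, d ^ 2) ∈ [((0 : ℤ), (1 : ℤ)), (1, 1), (-1, 1), (2, 1), (1, 4), (6, 1), (-5, 9)] := by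
  decide +kernel

lemma mem_zmultiples_of_X_eq {x y y' : ℚ} {h : E₁.toAffine.Nonsingular x y}
    {h' : E₁.toAffine.Nonsingular x y'}
    (hmem : Point.some x y h ∈ AddSubgroup.zmultiples originE₁) :
    Point.some x y' h' ∈ AddSubgroup.zmultiples originE₁ := by
  rcases (Point.X_eq_iff (h₁ := h') (h₂ := h)).mp rfl with e | e
  · rwa [e]
  · rw [e]; exact neg_mem hmem

lemma mem_zmultiples_of_add {x y : ℚ} (x' y' : ℚ) {h : E₁.toAffine.Nonsingular x y}
    (hmem : Point.some x y h ∈ AddSubgroup.zmultiples originE₁) (hx : x ≠ 0)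
    (h' : E₁.toAffine.Nonsingular x' y') (hX : (-y - x) / x ^ 2 = x') :
    Point.some x' y' h' ∈ AddSubgroup.zmultiples originE₁ := by
  subst hX
  obtain ⟨_, _, e⟩ := some_add_originE₁ h hx
  exact mem_zmultiples_of_X_eq (e ▸ add_mem hmem (AddSubgroup.mem_zmultiples originE₁))

lemma mem_zmultiples_of_height_le {x y : ℚ} (h : E₁.toAffine.Nonsingular x y)
    (hx : ratHeight x ≤ 22) : Point.some x y h ∈ AddSubgroup.zmultiples originE₁ := by
  obtain ⟨a, d, r, hd, had, hnum, hden, hxa, -, hr⟩ := exists_coords_E₁ (nonsingular_E₁_iff.mp h)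
  have ha : |a| ≤ 22 := (hnum ▸ num_le_ratHeight x).trans (by exact_mod_cast hx)
  have hd2 : d ^ 2 ≤ 22 := (hden ▸ den_le_ratHeight x).trans (by exact_mod_cast hx)
  have hlist := mem_list_of_isSquare a (Finset.mem_Icc.mpr (abs_le.mp ha)) d
    (Finset.mem_Icc.mpr ⟨by nlinarith, by nlinarith⟩) hd (Int.isCoprime_iff_gcd_eq_one.mp had)
    ⟨2 * r + d ^ 3, by linear_combination -4 * hr⟩
  have m₁ := AddSubgroup.mem_zmultiples originE₁
  have m₂ : Point.some 1 0 (nonsingular_E₁_iff.mpr (by norm_num)) ∈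
      AddSubgroup.zmultiples originE₁ := by
    obtain ⟨y', h', e⟩ := two_nsmul_some (nonsingular_E₁_iff.mpr
      (by norm_num : (0 : ℚ) ^ 2 + 0 = 0 ^ 3 - 0))
    have hX : ((3 * (0 : ℚ) ^ 2 - 1) / (2 * 0 + 1)) ^ 2 - 2 * 0 = 1 := by norm_num
    have := e ▸ nsmul_mem m₁ 2
    simp only [hX] at this
    exact mem_zmultiples_of_X_eq this
  have m₃ := mem_zmultiples_of_add (-1) (-1) m₂ (by norm_num)
    (nonsingular_E₁_iff.mpr (by norm_num)) (by norm_num)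
  have m₄ := mem_zmultiples_of_add 2 (-3) m₃ (by norm_num)
    (nonsingular_E₁_iff.mpr (by norm_num)) (by norm_num)
  have m₅ := mem_zmultiples_of_add (1 / 4) (-5 / 8) m₄ (by norm_num)
    (nonsingular_E₁_iff.mpr (by norm_num)) (by norm_num)
  have m₆ := mem_zmultiples_of_add 6 14 m₅ (by norm_num)
    (nonsingular_E₁_iff.mpr (by norm_num)) (by norm_num)
  have m₇ := mem_zmultiples_of_add (-5 / 9) (8 / 27) m₆ (by norm_num)
    (nonsingular_E₁_iff.mpr (by norm_num)) (by norm_num)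
  have hxd : x = a / ((d ^ 2 : ℤ) : ℚ) := by rw [hxa]; push_cast; rfl
  have hx' : x = 0 ∨ x = 1 ∨ x = -1 ∨ x = 2 ∨ x = 1 / 4 ∨ x = 6 ∨ x = -5 / 9 := by
    simp only [List.mem_cons, Prod.mk.injEq, List.not_mem_nil, or_false] at hlist
    rcases hlist with ⟨ha, hd⟩ | ⟨ha, hd⟩ | ⟨ha, hd⟩ | ⟨ha, hd⟩ | ⟨ha, hd⟩ | ⟨ha, hd⟩ | ⟨ha, hd⟩ <;>
      · rw [hxd, ha, hd]; norm_num
  rcases hx' with rfl | rfl | rfl | rfl | rfl | rfl | rfl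
  · exact mem_zmultiples_of_X_eq m₁
  · exact mem_zmultiples_of_X_eq m₂
  · exact mem_zmultiples_of_X_eq m₃
  · exact mem_zmultiples_of_X_eq m₄
  · exact mem_zmultiples_of_X_eq m₅
  · exact mem_zmultiples_of_X_eq m₆
  · exact mem_zmultiples_of_X_eq m₇

lemma ratHeight_lt_of_two_nsmul {x y x' y' : ℚ} {B : ℕ} {h : E₁.toAffine.Nonsingular x y}
    {h' : E₁.toAffine.Nonsingular x' y'} (e : Point.some x y h = 2 • Point.some x' y' h')
    (hB : 22 < B) (hx : ratHeight x ≤ 3 * B ^ 2) : ratHeight x' < B := by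
  obtain ⟨_, _, e'⟩ := two_nsmul_some h'
  have hX := (Point.some.inj (e.trans e')).1
  have h4 := ratHeight_double (disc_ne_zero x') (hX ▸ two_nsmul_X_mul h')
  by_contra! hle
  have : B ^ 4 ≤ ratHeight x' ^ 4 := Nat.pow_le_pow_left hle 4
  have : 23 ^ 2 ≤ B ^ 2 := Nat.pow_le_pow_left hB 2
  nlinarith

lemma mem_zmultiples_originE₁ (P : E₁.toAffine.Point) :
    P ∈ AddSubgroup.zmultiples originE₁ := by
  match P with
  | .zero => exact zero_mem _
  | .some x y h =>
    induction hn : ratHeight x using Nat.strong_induction_on generalizing x y with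
    | _ n ih =>
    subst hn
    by_cases hsmall : ratHeight x ≤ 22
    · exact mem_zmultiples_of_height_le h hsmall
    rw [not_le] at hsmall
    have descend {x₁ y₁ : ℚ} (h₁ : E₁.toAffine.Nonsingular x₁ y₁)
        (hle : ratHeight x₁ ≤ 3 * ratHeight x ^ 2) (Q : E₁.toAffine.Point)
        (e : Point.some x₁ y₁ h₁ = 2 • Q) :
        Point.some x₁ y₁ h₁ ∈ AddSubgroup.zmultiples originE₁ := by
      rw [e]
      refine nsmul_mem ?_ 2
      match Q, e with
      | .zero, _ => exact zero_mem _
      | .some x₂ y₂ h₂, e => exact ih _ (ratHeight_lt_of_two_nsmul e hsmall hle) _ _ h₂ rfl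
    obtain ⟨Q, hQ | hQ⟩ := exists_two_nsmul_or (.some x y h)
    · exact descend h (by nlinarith) Q hQ
    · have hx : x ≠ 0 := by
        rintro rfl
        norm_num [ratHeight] at hsmall
      obtain ⟨y', h', e⟩ := some_add_originE₁ h hx
      rw [← add_mem_cancel_right (AddSubgroup.mem_zmultiples originE₁), e]
      exact descend h' (ratHeight_add (nonsingular_E₁_iff.mp h) hx rfl) Q (e ▸ hQ)

lemma nsmul_originE₁_ne_zero {n : ℕ} (hn : n ≠ 0) : n • originE₁ ≠ 0 := by
  induction n using Nat.strong_induction_on with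
  | _ n ih =>
  rcases n.even_or_odd' with ⟨k, rfl | rfl⟩
  · rw [mul_nsmul']
    exact two_nsmul_ne_zero (ih k (by lia) (by lia))
  · intro h0
    apply originE₁_ne_two_nsmul (-(k • originE₁))
    rw [neg_nsmul, ← mul_nsmul']
    rw [add_nsmul, one_nsmul] at h0
    exact eq_neg_of_add_eq_zero_right h0

/-- The Mordell–Weil group of the elliptic curve `37.a1 : y² + y = x³ - x` over `ℚ` is
isomorphic to `ℤ`; in particular it has rank `1` and trivial torsion. -/
theorem mordell_weil_37a1 : Nonempty (E₁.toAffine.Point ≃+ ℤ) := by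
  have hinj : Function.Injective (zmultiplesHom _ originE₁) := by
    rw [injective_iff_map_eq_zero]
    intro n hn
    by_contra hn0
    rw [zmultiplesHom_apply] at hn
    apply nsmul_originE₁_ne_zero (Int.natAbs_ne_zero.mpr hn0)
    rcases Int.natAbs_eq n with h | h <;> rw [h] at hn <;> simpa using hn
  have hsurj : Function.Surjective (zmultiplesHom _ originE₁) := fun P =>
    AddSubgroup.mem_zmultiples_iff.mp (mem_zmultiples_originE₁ P)
  exact ⟨(AddEquiv.ofBijective _ ⟨hinj, hsurj⟩).symm⟩
end

section
/- Let K be a subfield of ℂ with [K : ℚ] ≤ 2 and suppose (x₁, x₂, x₃, x₄, x₅) ∈ K⁵ is a nonzero tuple satisfying x₁ + x₂ + x₃ + x₄ + x₅ = 0, x₁² + x₂² + x₃² + x₄² + x₅² = 0, and x₁³ + x₂³ + x₃³ + x₄³ + x₅³ = 0. Then K = ℚ(i), and there exist a nonzero scalar λ ∈ K and a permutation σ of the five coordinates such that (x_{σ(1)}, x_{σ(2)}, x_{σ(3)}, x_{σ(4)}, x_{σ(5)}) equals λ·(1, i, −1, −i, 0) or λ·(1, −i, −1, i, 0). In particular,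 all quadratic points of Bring's curve are defined over ℚ(i) and, up to permutation of coordinates and scaling, are the points (1 : ±i : −1 : ∓i : 0). -/
open Complex

/-- The ring of Eisenstein integers `ℤ[ω]`, where `ω ^ 2 = -1 - ω`. -/
abbrev EisensteinInt : Type := QuadraticAlgebra ℤ (-1) (-1)

namespace EisensteinInt

lemma norm_eq (z : EisensteinInt) :
    QuadraticAlgebra.norm z = z.re ^ 2 - z.re * z.im + z.im ^ 2 := by
  rw [QuadraticAlgebra.norm_def]; ring

lemma norm_nonneg (z : EisensteinInt) : 0 ≤ QuadraticAlgebra.norm z := by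
  rw [norm_eq]; nlinarith [sq_nonneg (z.re - z.im), sq_nonneg (z.re + z.im)]

lemma norm_eq_zero {z : EisensteinInt} (h : QuadraticAlgebra.norm z = 0) : z = 0 := by
  rw [norm_eq] at h
  have h1 : z.re = 0 := by
    nlinarith [sq_nonneg (z.re - 2 * z.im), sq_nonneg z.re]
  have h2 : z.im = 0 := by
    nlinarith [sq_nonneg (2 * z.re - z.im), sq_nonneg z.im]
  ext <;> simp [h1, h2]

instance : Nontrivial EisensteinInt :=
  ⟨0, 1, fun h => zero_ne_one (congrArg QuadraticAlgebra.re h)⟩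

/-- Division of integers rounded to a nearest integer. -/
def roundDiv (a n : ℤ) : ℤ := (2 * a + n) / (2 * n)

lemma sub_mul_roundDiv_sq_le (a : ℤ) {n : ℤ} (hn : 0 < n) :
    -n ≤ 2 * (a - n * roundDiv a n) ∧ 2 * (a - n * roundDiv a n) ≤ n := by
  have h1 := Int.mul_ediv_add_emod (2 * a + n) (2 * n)
  have h2 := Int.emod_nonneg (2 * a + n) (show 2 * n ≠ 0 by omega)
  have h3 := Int.emod_lt_of_pos (2 * a + n) (show 0 < 2 * n by omega)
  unfold roundDiv
  constructor <;> nlinarith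

/-- Division of Eisenstein integers rounded to a nearby Eisenstein integer. -/
def quo (x y : EisensteinInt) : EisensteinInt :=
  ⟨roundDiv (x * star y).re (QuadraticAlgebra.norm y),
    roundDiv (x * star y).im (QuadraticAlgebra.norm y)⟩

lemma norm_sub_mul_quo_lt (x : EisensteinInt) {y : EisensteinInt} (hy : y ≠ 0) :
    QuadraticAlgebra.norm (x - y * quo x y) < QuadraticAlgebra.norm y := by
  have hn : 0 < QuadraticAlgebra.norm y :=
    lt_of_le_of_ne (norm_nonneg y) fun h => hy (norm_eq_zero h.symm)
  obtain ⟨h1, h2⟩ := sub_mul_roundDiv_sq_le (x * star y).re hn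
  obtain ⟨h3, h4⟩ := sub_mul_roundDiv_sq_le (x * star y).im hn
  have key : (x - y * quo x y) * star y =
      ⟨(x * star y).re - QuadraticAlgebra.norm y * roundDiv (x * star y).re (QuadraticAlgebra.norm y),
       (x * star y).im -
        QuadraticAlgebra.norm y * roundDiv (x * star y).im (QuadraticAlgebra.norm y)⟩ := by
    have : (x - y * quo x y) * star y = x * star y - (y * star y) * quo x y := by ring
    rw [this, ← QuadraticAlgebra.algebraMap_norm_eq_mul_star]
    ext <;> simp [quo]
  have hN := (congrArg QuadraticAlgebra.norm key).trans (norm_eq _)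
  rw [map_mul, QuadraticAlgebra.norm_star] at hN
  dsimp only at hN
  set n := QuadraticAlgebra.norm y
  set r := (x * star y).re - n * roundDiv (x * star y).re n
  set s := (x * star y).im - n * roundDiv (x * star y).im n
  have : 4 * (r ^ 2 - r * s + s ^ 2) ≤ 3 * n ^ 2 := by
    nlinarith [mul_nonneg (sub_nonneg.2 h2) (sub_nonneg.2 h1),
      mul_nonneg (sub_nonneg.2 h4) (sub_nonneg.2 h3),
      mul_nonneg (sub_nonneg.2 h2) (sub_nonneg.2 h3),
      mul_nonneg (sub_nonneg.2 h1) (sub_nonneg.2 h4),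
      mul_nonneg (sub_nonneg.2 h2) (sub_nonneg.2 h4),
      mul_nonneg (sub_nonneg.2 h1) (sub_nonneg.2 h3), sq_nonneg (r + s), sq_nonneg (r - s)]
  nlinarith

instance : NoZeroDivisors EisensteinInt where
  eq_zero_or_eq_zero_of_mul_eq_zero {a b} h := by
    have := congrArg QuadraticAlgebra.norm h
    rw [map_mul, QuadraticAlgebra.norm_zero, mul_eq_zero] at this
    exact this.imp norm_eq_zero norm_eq_zero

instance : IsDomain EisensteinInt := NoZeroDivisors.to_isDomain _

instance : EuclideanDomain EisensteinInt where
  quotient := quo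
  quotient_zero x := by ext <;> simp [quo, roundDiv, QuadraticAlgebra.norm_zero]
  remainder x y := x - y * quo x y
  quotient_mul_add_remainder_eq x y := by ring
  r x y := (QuadraticAlgebra.norm x).natAbs < (QuadraticAlgebra.norm y).natAbs
  r_wellFounded := (measure fun x : EisensteinInt => (QuadraticAlgebra.norm x).natAbs).wf
  remainder_lt x y hy :=
    Int.natAbs_lt_natAbs_of_nonneg_of_lt (norm_nonneg _) (norm_sub_mul_quo_lt x hy)
  mul_left_not_lt x y hy := by
    rw [map_mul, Int.natAbs_mul, not_lt]
    exact Nat.le_mul_of_pos_right _ (Int.natAbs_pos.2 fun h => hy (norm_eq_zero h))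

lemma unit_cases {z : EisensteinInt} (h : IsUnit z) :
    ∃ e : ℤ, (e = 1 ∨ e = -1) ∧ (z = ⟨e, 0⟩ ∨ z = ⟨0, e⟩ ∨ z = ⟨-e, -e⟩) := by
  have h1 : QuadraticAlgebra.norm z = 1 := by
    have := Int.isUnit_iff.1 (QuadraticAlgebra.isUnit_iff_norm_isUnit.1 h)
    have := norm_nonneg z
    omega
  rw [norm_eq] at h1
  obtain ⟨a, b⟩ := z
  dsimp only at h1
  have ha : a ≤ 1 := by nlinarith [sq_nonneg (a - 2 * b)]
  have ha' : -1 ≤ a := by nlinarith [sq_nonneg (a - 2 * b)]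
  have hb : b ≤ 1 := by nlinarith [sq_nonneg (2 * a - b)]
  have hb' : -1 ≤ b := by nlinarith [sq_nonneg (2 * a - b)]
  have e1 : a = -1 ∨ a = 0 ∨ a = 1 := by omega
  have e2 : b = -1 ∨ b = 0 ∨ b = 1 := by omega
  rcases e1 with rfl | rfl | rfl <;> rcases e2 with rfl | rfl | rfl <;> simp at h1 ⊢

end EisensteinInt

/-- If `X + Yω` has coprime trace and norm and its norm is a cube, then it is a cube up to a
power of `ω`. -/
lemma eisenstein_cube_of_norm_cube {X Y n : ℤ} (h : X ^ 2 - X * Y + Y ^ 2 = n ^ 3)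
    (hc : IsCoprime (2 * X - Y) n) :
    ∃ x y : ℤ, n = x ^ 2 - x * y + y ^ 2 ∧
      ((X = x ^ 3 - 3 * x * y ^ 2 + y ^ 3 ∧ Y = 3 * x ^ 2 * y - 3 * x * y ^ 2) ∨
       (X = -(3 * x ^ 2 * y - 3 * x * y ^ 2) ∧
          Y = x ^ 3 - 3 * x ^ 2 * y + y ^ 3) ∨
       (X = -(x ^ 3 - 3 * x ^ 2 * y + y ^ 3) ∧ Y = -(x ^ 3 - 3 * x * y ^ 2 + y ^ 3))) := by
  set z : EisensteinInt := ⟨X, Y⟩ with hz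
  have hmul : z * star z = (n : EisensteinInt) ^ 3 := by
    rw [← QuadraticAlgebra.algebraMap_norm_eq_mul_star, EisensteinInt.norm_eq]
    rw [hz]; dsimp only; rw [h]; simp
  have hadd : z + star z = ((2 * X - Y : ℤ) : EisensteinInt) := by
    ext
    · rw [QuadraticAlgebra.re_intCast]; simp [hz]; ring
    · rw [QuadraticAlgebra.im_intCast]; simp [hz]
  have hco : IsCoprime z (star z) := by
    have h1 : IsCoprime (z + star z) (z * star z) := by
      rw [hadd, hmul]
      exact (hc.map (Int.castRingHom EisensteinInt)).pow_right
    obtain ⟨a, b, hab⟩ := h1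
    exact ⟨a + b * star z, a, by rw [← hab]; ring⟩
  obtain ⟨g, u, hu⟩ := exists_associated_pow_of_mul_eq_pow' hco hmul
  have aux : ∀ e : ℤ, (e = 1 ∨ e = -1) → ∃ x y : ℤ,  (g ^ 3 * (e : EisensteinInt)) = 
      ⟨x ^ 3 - 3 * x * y ^ 2 + y ^ 3, 3 * x ^ 2 * y - 3 * x * y ^ 2⟩ := by
    obtain ⟨x, y⟩ := g
    rintro e (rfl | rfl)
    · exact ⟨x, y, by ext <;> simp [pow_succ] <;> ring⟩
    · exact ⟨-x, -y, by ext <;> simp [pow_succ] <;> ring⟩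
  obtain ⟨e, he, hcases⟩ := EisensteinInt.unit_cases u.isUnit
  obtain ⟨x, y, hxy⟩ := aux e he
  have hcases' : ((X = x ^ 3 - 3 * x * y ^ 2 + y ^ 3 ∧ Y = 3 * x ^ 2 * y - 3 * x * y ^ 2) ∨
       (X = -(3 * x ^ 2 * y - 3 * x * y ^ 2) ∧
          Y = x ^ 3 - 3 * x ^ 2 * y + y ^ 3) ∨
       (X = -(x ^ 3 - 3 * x ^ 2 * y + y ^ 3) ∧ Y = -(x ^ 3 - 3 * x * y ^ 2 + y ^ 3))) := by
    have hw : ∀ w : EisensteinInt, (u : EisensteinInt) = e * w →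
        z = ⟨x ^ 3 - 3 * x * y ^ 2 + y ^ 3, 3 * x ^ 2 * y - 3 * x * y ^ 2⟩ * w := by
      intro w hw
      rw [← hxy, ← hu, hw]; ring
    rcases hcases with h | h | h
    · have := hw 1 (by rw [h]; ext <;> simp)
      left
      exact ⟨by simpa using congrArg QuadraticAlgebra.re this,
        by simpa using congrArg QuadraticAlgebra.im this⟩
    · have := hw ⟨0, 1⟩ (by rw [h]; ext <;> simp)
      right; left
      refine ⟨(congrArg QuadraticAlgebra.re this).trans ?_,
        (congrArg QuadraticAlgebra.im this).trans ?_⟩ <;> simp <;> ring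
    · have := hw ⟨-1, -1⟩ (by rw [h]; ext <;> simp)
      right; right
      refine ⟨(congrArg QuadraticAlgebra.re this).trans ?_,
        (congrArg QuadraticAlgebra.im this).trans ?_⟩ <;> simp <;> ring
  refine ⟨x, y, ?_, hcases'⟩
  refine (Odd.strictMono_pow (R := ℤ) (n := 3) (by decide)).injective ?_
  refine h.symm.trans ?_
  rcases hcases' with ⟨rfl, rfl⟩ | ⟨rfl, rfl⟩ | ⟨rfl, rfl⟩ <;> ring

lemma isCoprime_of_forall_prime {a b : ℤ} (ha : a ≠ 0)
    (h : ∀ p : ℤ, Prime p → p ∣ a → p ∣ b → False) : IsCoprime a b :=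
  isCoprime_of_prime_dvd (fun h0 => ha h0.1) fun p hp h1 h2 => h p hp h1 h2

lemma IsCoprime.not_prime_dvd {a b p : ℤ} (h : IsCoprime a b) (hp : Prime p) (h1 : p ∣ a)
    (h2 : p ∣ b) : False :=
  hp.not_isUnit (h.isUnit_of_dvd' h1 h2)

/-- The factor `3u + 3v + 5w` of `-10w³` is divisible by ten. -/
lemma ten_dvd_of_cubic {u v w : ℤ}
    (h : u ^ 3 + v ^ 3 + 5 * w ^ 3 = 5 * u * v * w) : (10 : ℤ) ∣ 3 * u + 3 * v + 5 * w := by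
  have h2 : (2 : ℤ) ∣ 3 * u + 3 * v + 5 * w := by
    have key : ∀ a b c : ZMod 4, a ^ 3 + b ^ 3 + 5 * c ^ 3 = 5 * a * b * c →
        2 * (3 * a + 3 * b + 5 * c) = 0 := by decide
    have := key u v w (by exact_mod_cast congrArg (Int.cast : ℤ → ZMod 4) h)
    have : ((2 * (3 * u + 3 * v + 5 * w) : ℤ) : ZMod 4) = 0 := by push_cast; exact this
    rw [ZMod.intCast_zmod_eq_zero_iff_dvd] at this
    omega
  have h5 : (5 : ℤ) ∣ 3 * u + 3 * v + 5 * w := by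
    have key : ∀ a b c : ZMod 5, a ^ 3 + b ^ 3 + 5 * c ^ 3 = 5 * a * b * c →
        3 * a + 3 * b + 5 * c = 0 := by decide
    have := key u v w (by exact_mod_cast congrArg (Int.cast : ℤ → ZMod 5) h)
    have : ((3 * u + 3 * v + 5 * w : ℤ) : ZMod 5) = 0 := by push_cast; exact this
    rwa [ZMod.intCast_zmod_eq_zero_iff_dvd] at this
  omega

lemma nine_dvd_of_cubic {u v w : ℤ} (huw : IsCoprime u w) (hvw : IsCoprime v w)
    (h : u ^ 3 + v ^ 3 + 5 * w ^ 3 = 5 * u * v * w) (h3 : (3 : ℤ) ∣ w) : (9 : ℤ) ∣ w := by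
  obtain ⟨c, rfl⟩ := h3
  have hsum : (3 : ℤ) ∣ u + v := by
    have key : ∀ a b : ZMod 3, a ^ 3 + b ^ 3 = 0 → a + b = 0 := by decide
    have h0 : ((u ^ 3 + v ^ 3 : ℤ) : ZMod 3) = 0 := by
      rw [ZMod.intCast_zmod_eq_zero_iff_dvd]
      exact ⟨5 * u * v * c - 45 * c ^ 3, by push_cast; linarith⟩
    have := key u v (by exact_mod_cast h0)
    have : ((u + v : ℤ) : ZMod 3) = 0 := by push_cast; exact this
    rwa [ZMod.intCast_zmod_eq_zero_iff_dvd] at this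
  obtain ⟨k, hk⟩ := hsum
  have hdvd : (3 : ℤ) ∣ 5 * (u * v * c) := by
    refine ⟨3 * k ^ 3 - k * u * v + 15 * c ^ 3, ?_⟩
    have : u = 3 * k - v := by linarith
    subst this
    linarith
  have h3p : Prime (3 : ℤ) := Int.prime_three
  rcases h3p.dvd_or_dvd hdvd with h | h
  · omega
  rcases h3p.dvd_or_dvd h with h | h
  · rcases h3p.dvd_or_dvd h with h | h
    · exact (huw.not_prime_dvd h3p h ⟨c, rfl⟩).elim
    · exact (hvw.not_prime_dvd h3p h ⟨c, rfl⟩).elim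
  · omega

/-- Cube extraction from `a N = -w³` with `a`, `N` coprime. -/
lemma exists_cubes_of_mul_eq_neg_cube {a N w : ℤ} (hc : IsCoprime a N) (h : a * N = -w ^ 3) :
    ∃ s n : ℤ, a = s ^ 3 ∧ N = n ^ 3 ∧ w = -(s * n) := by
  have h' : a * N = (-w) ^ 3 := by rw [h]; ring
  obtain ⟨⟨s, rfl⟩, ⟨n, rfl⟩⟩ := Int.eq_pow_of_mul_eq_pow_odd hc (by decide) h'
  refine ⟨s, n, rfl, rfl, ?_⟩
  have : s * n = -w := by
    refine (Odd.strictMono_pow (R := ℤ) (n := 3) (by decide)).injective ?_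
    exact (mul_pow s n 3).trans h'
  linarith

lemma descent_of_not_three_dvd {u v w : ℤ} (huw : IsCoprime u w)
    (hvw : IsCoprime v w) (hw : w ≠ 0) (h : u ^ 3 + v ^ 3 + 5 * w ^ 3 = 5 * u * v * w)
    (h3 : ¬ (3 : ℤ) ∣ w) :
    ∃ b x y : ℤ, b ∣ w ∧
      2 * x ^ 3 - 3 * x ^ 2 * y - 3 * x * y ^ 2 + 2 * y ^ 3 + 10 * b ^ 3
        + 15 * b * (x ^ 2 - x * y + y ^ 2) = 0 := by
  obtain ⟨a, ha⟩ := ten_dvd_of_cubic h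
  set N := 9 * u ^ 2 + 9 * v ^ 2 + 25 * w ^ 2 - 9 * u * v - 15 * u * w - 15 * v * w with hN
  have hprod : a * N = -w ^ 3 := by
    have : 10 * (a * N) = 10 * (-w ^ 3) := by
      rw [← mul_assoc, ← ha, hN]; linear_combination 27 * h
    linarith
  have ha0 : a ≠ 0 := by
    rintro rfl
    have : w ^ 3 = 0 := by linarith
    exact hw (by simpa using this)
  have hN0 : N ≠ 0 := by
    intro h0
    rw [h0] at hprod
    have : w ^ 3 = 0 := by linarith
    exact hw (by simpa using this)
  have hdw : ∀ p : ℤ, Prime p → p ∣ N → p ∣ w := fun p hp hpN =>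
    hp.dvd_of_dvd_pow (n := 3) ((dvd_neg).1 (hprod ▸ hpN.mul_left a))
  have hp3 : ∀ p : ℤ, Prime p → p ∣ w → ¬ p ∣ 3 := fun p hp hpw hp3 => by
    have : Associated p 3 := hp.associated_of_dvd Int.prime_three hp3
    exact h3 (this.symm.dvd.trans hpw)
  have huvp : ∀ p : ℤ, Prime p → p ∣ w → p ∣ u * v → False := fun p hp hpw hpuv => by
    rcases hp.dvd_or_dvd hpuv with h | h
    · exact huw.not_prime_dvd hp h hpw
    · exact hvw.not_prime_dvd hp h hpw
  have hq : ∀ p : ℤ, Prime p → p ∣ w → p ∣ N → p ∣ u ^ 2 - u * v + v ^ 2 :=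
    fun p hp hpw hpN => by
      have h9 : p ∣ 3 * (3 * (u ^ 2 - u * v + v ^ 2)) := by
        have e : 3 * (3 * (u ^ 2 - u * v + v ^ 2)) = N - w * (25 * w - 15 * u - 15 * v) := by
          rw [hN]; ring
        rw [e]; exact dvd_sub hpN (hpw.mul_right _)
      have := (hp.dvd_or_dvd h9).resolve_left (hp3 p hp hpw)
      exact (hp.dvd_or_dvd this).resolve_left (hp3 p hp hpw)
  have hcop1 : IsCoprime a N := by
    refine isCoprime_of_forall_prime ha0 fun p hp hpa hpN => ?_
    have hpw := hdw p hp hpN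
    have hs : p ∣ 3 * (u + v) := by
      have e : 3 * (u + v) = 10 * a - 5 * w := by linarith
      rw [e]; exact dvd_sub (hpa.mul_left _) (hpw.mul_left _)
    have hs := (hp.dvd_or_dvd hs).resolve_left (hp3 p hp hpw)
    have h3uv : p ∣ 3 * (u * v) := by
      have e : 3 * (u * v) = (u + v) * (u + v) - (u ^ 2 - u * v + v ^ 2) := by ring
      rw [e]; exact dvd_sub (hs.mul_right _) (hq p hp hpw hpN)
    exact huvp p hp hpw ((hp.dvd_or_dvd h3uv).resolve_left (hp3 p hp hpw))
  obtain ⟨s, n, hs, hn, hwsn⟩ := exists_cubes_of_mul_eq_neg_cube hcop1 hprod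
  have hn0 : n ≠ 0 := by rintro rfl; exact hN0 (by rw [hn]; ring)
  have hcop2 : IsCoprime (2 * (3 * u - 5 * w) - (3 * v - 5 * w)) n := by
    refine (isCoprime_of_forall_prime hn0 fun p hp hpn hpt => ?_).symm
    have hpN : p ∣ N := hn ▸ hpn.pow (by norm_num)
    have hpw := hdw p hp hpN
    have h1 : p ∣ 3 * (2 * u - v) := by
      have e : 3 * (2 * u - v) = (2 * (3 * u - 5 * w) - (3 * v - 5 * w)) + w * 5 := by ring
      rw [e]; exact dvd_add hpt (hpw.mul_right _)
    have h1 := (hp.dvd_or_dvd h1).resolve_left (hp3 p hp hpw)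
    have h2 : p ∣ 3 * u ^ 2 := by
      have e : 3 * u ^ 2 = (u ^ 2 - u * v + v ^ 2) + (2 * u - v) * (u + v) := by ring
      rw [e]; exact dvd_add (hq p hp hpw hpN) (h1.mul_right _)
    have h2 := hp.dvd_of_dvd_pow ((hp.dvd_or_dvd h2).resolve_left (hp3 p hp hpw))
    exact huvp p hp hpw (h2.mul_right v)
  obtain ⟨x, y, hxy, hcases⟩ := eisenstein_cube_of_norm_cube
    (X := 3 * u - 5 * w) (Y := 3 * v - 5 * w) (n := n) (by rw [← hn, hN]; ring) hcop2
  rcases hcases with ⟨h1, h2⟩ | ⟨h1, h2⟩ | ⟨h1, h2⟩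
  · have : (3 : ℤ) ∣ 5 * w := ⟨v - x ^ 2 * y + x * y ^ 2, by linarith⟩
    omega
  · have : (3 : ℤ) ∣ 5 * w := ⟨u + x ^ 2 * y - x * y ^ 2, by linarith⟩
    omega
  · refine ⟨s, x, y, ⟨-n, by rw [hwsn]; ring⟩, ?_⟩
    rw [← hxy, ← hs]
    linear_combination 15 * hwsn + h1 + h2 - ha

lemma descent_of_three_dvd {u v w : ℤ} (huw : IsCoprime u w)
    (hvw : IsCoprime v w) (hw : w ≠ 0) (h : u ^ 3 + v ^ 3 + 5 * w ^ 3 = 5 * u * v * w)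
    (h3 : (3 : ℤ) ∣ w) :
    ∃ b x y : ℤ, b ∣ w ∧
      2 * x ^ 3 - 3 * x ^ 2 * y - 3 * x * y ^ 2 + 2 * y ^ 3 + 10 * b ^ 3
        + 15 * b * (x ^ 2 - x * y + y ^ 2) = 0 := by
  have h10 := ten_dvd_of_cubic h
  obtain ⟨c, hc⟩ := nine_dvd_of_cubic huw hvw h h3
  have huvp : ∀ p : ℤ, Prime p → p ∣ w → p ∣ u * v → False := fun p hp hpw hpuv => by
    rcases hp.dvd_or_dvd hpuv with h | h
    · exact huw.not_prime_dvd hp h hpw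
    · exact hvw.not_prime_dvd hp h hpw
  have hpcw : ∀ p : ℤ, p ∣ c → p ∣ w := fun p hp => hc ▸ hp.mul_left 9
  have hsum : (3 : ℤ) ∣ u + v := by
    have key : ∀ a b : ZMod 3, a ^ 3 + b ^ 3 = 0 → a + b = 0 := by decide
    have h0 : ((u ^ 3 + v ^ 3 : ℤ) : ZMod 3) = 0 := by
      rw [ZMod.intCast_zmod_eq_zero_iff_dvd]
      exact ⟨15 * u * v * c - 1215 * c ^ 3, by rw [hc] at h; push_cast; linarith⟩
    have := key u v (by exact_mod_cast h0)
    have : ((u + v : ℤ) : ZMod 3) = 0 := by push_cast; exact this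
    rwa [ZMod.intCast_zmod_eq_zero_iff_dvd] at this
  obtain ⟨k, hk⟩ := hsum
  have hu : u = 3 * k - v := by linarith
  -- `M` is a third of the norm of `u + ωv + 5ω²(w/3)`
  set M := 3 * (k + 5 * c) ^ 2 - u * v - 15 * u * c - 15 * v * c with hM
  have hprod : (k + 5 * c) * M = -10 * c ^ 3 * 3 := by
    have : 9 * ((k + 5 * c) * M) = 9 * (-10 * c ^ 3 * 3) := by
      rw [hM]; rw [hc, hu] at h; rw [hu]; linear_combination h
    linarith
  have h3M : ¬ (3 : ℤ) ∣ M := fun hd => by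
    refine huvp 3 Int.prime_three h3 ?_
    have e : u * v = 3 * ((k + 5 * c) ^ 2 - 5 * u * c - 5 * v * c) - M := by rw [hM]; ring
    rw [e]; exact dvd_sub (Dvd.intro _ rfl) hd
  have h3k : (3 : ℤ) ∣ k + 5 * c :=
    (Int.prime_three.dvd_or_dvd (⟨-10 * c ^ 3, by linarith⟩ : (3 : ℤ) ∣ (k + 5 * c) * M)).resolve_right
      h3M
  obtain ⟨a, ha⟩ : (30 : ℤ) ∣ k + 5 * c := by omega
  rw [ha] at hM hprod
  have hprod : a * M = -c ^ 3 := by linarith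
  have hc0 : c ≠ 0 := by rintro rfl; exact hw (by rw [hc]; ring)
  have ha0 : a ≠ 0 := by
    rintro rfl
    have : c ^ 3 = 0 := by linarith
    exact hc0 (by simpa using this)
  have hM0 : M ≠ 0 := by
    intro h0; exact h3M (h0 ▸ dvd_zero _)
  have hdc : ∀ p : ℤ, Prime p → p ∣ M → p ∣ c := fun p hp hpN =>
    hp.dvd_of_dvd_pow (n := 3) ((dvd_neg).1 (hprod ▸ hpN.mul_left a))
  have hcop1 : IsCoprime a M := by
    refine isCoprime_of_forall_prime ha0 fun p hp hpa hpM => ?_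
    have hpc := hdc p hp hpM
    refine huvp p hp (hpcw p hpc) ?_
    have e : u * v = a * (2700 * a) - c * (15 * u + 15 * v) - M := by rw [hM]; ring
    rw [e]
    exact dvd_sub (dvd_sub (hpa.mul_right _) (hpc.mul_right _)) hpM
  obtain ⟨s, n, hs, hn, hcsn⟩ := exists_cubes_of_mul_eq_neg_cube hcop1 hprod
  have hn0 : n ≠ 0 := by rintro rfl; exact hM0 (by rw [hn]; ring)
  have hcop2 : IsCoprime (2 * (2 * k - v - 5 * c) - (k - 10 * c)) n := by
    refine (isCoprime_of_forall_prime hn0 fun p hp hpn hpt => ?_).symm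
    have hpM : p ∣ M := hn ▸ hpn.pow (by norm_num)
    have hpc := hdc p hp hpM
    refine huvp p hp (hpcw p hpc) ?_
    have e : u * v = 3 * M - c * (225 * c - 15 * u - 15 * v)
        - (2 * (2 * k - v - 5 * c) - (k - 10 * c)) * (u - v) := by
      rw [hM, ← ha, hu]; ring
    rw [e]
    exact dvd_sub (dvd_sub (hpM.mul_left _) (hpc.mul_right _)) (hpt.mul_right _)
  obtain ⟨x, y, hxy, hcases⟩ := eisenstein_cube_of_norm_cube
    (X := 2 * k - v - 5 * c) (Y := k - 10 * c) (n := n)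
    (by rw [← hn, hM, ← ha, hu]; ring) hcop2
  have hv3 : ¬ (3 : ℤ) ∣ v := fun hd => hvw.not_prime_dvd Int.prime_three hd h3
  rcases hcases with ⟨h1, h2⟩ | ⟨h1, h2⟩ | ⟨h1, h2⟩
  · refine ⟨-3 * s, x - 2 * y, 2 * x - y, ⟨3 * n, by rw [hc, hcsn]; ring⟩, ?_⟩
    linear_combination (-9) * h2 + 9 * ha + 270 * hs - 135 * hcsn + 135 * s * hxy
  · exact (hv3 ⟨20 * a - 5 * c + x ^ 2 * y - x * y ^ 2, by linarith⟩).elim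
  · exact (hv3 ⟨10 * a - x ^ 2 * y + x * y ^ 2, by linarith⟩).elim

lemma descent_of_cubic {u v w : ℤ} (huw : IsCoprime u w)
    (hvw : IsCoprime v w) (hw : w ≠ 0) (h : u ^ 3 + v ^ 3 + 5 * w ^ 3 = 5 * u * v * w) :
    ∃ b x y : ℤ, b ∣ w ∧
      2 * x ^ 3 - 3 * x ^ 2 * y - 3 * x * y ^ 2 + 2 * y ^ 3 + 10 * b ^ 3
        + 15 * b * (x ^ 2 - x * y + y ^ 2) = 0 := by
  by_cases h3 : (3 : ℤ) ∣ w
  · exact descent_of_three_dvd huw hvw hw h h3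
  · exact descent_of_not_three_dvd huw hvw hw h h3

lemma exists_solution_of_descent {b x y : ℤ}
    (h : 2 * x ^ 3 - 3 * x ^ 2 * y - 3 * x * y ^ 2 + 2 * y ^ 3 + 10 * b ^ 3
        + 15 * b * (x ^ 2 - x * y + y ^ 2) = 0) :
    ∃ p q r : ℤ, p + q + r = 5 * (-b) ∧ p * q * r = 5 * (-b) ^ 3 := by
  have h3 : (3 : ℤ) ∣ 2 * x - y - 5 * b := by
    have key : ∀ x y b : ZMod 3, 2 * x ^ 3 - 3 * x ^ 2 * y - 3 * x * y ^ 2 + 2 * y ^ 3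
        + 10 * b ^ 3 + 15 * b * (x ^ 2 - x * y + y ^ 2) = 0 → 2 * x - y - 5 * b = 0 := by decide
    have := key x y b (by exact_mod_cast congrArg (Int.cast : ℤ → ZMod 3) h)
    have : ((2 * x - y - 5 * b : ℤ) : ZMod 3) = 0 := by push_cast; exact this
    rwa [ZMod.intCast_zmod_eq_zero_iff_dvd] at this
  obtain ⟨k, hk⟩ := h3
  have hy : y = 2 * x - 5 * b - 3 * k := by linarith
  refine ⟨k, k - x, -b * 5 - k - (k - x), by ring, ?_⟩
  subst hy
  have : 27 * (k * (k - x) * (-b * 5 - k - (k - x))) = 27 * (5 * (-b) ^ 3) := by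
    linear_combination h
  linarith

lemma exists_smaller_solution {p q r e : ℤ} (he : e ≠ 0) (hs : p + q + 5 * r = 5 * e)
    (hm : p * q * r = e ^ 3) (hpq : IsCoprime p q) (hpr : IsCoprime p r) (hqr : IsCoprime q r) :
    ∃ p' q' r' e' : ℤ, e' ≠ 0 ∧ e'.natAbs < e.natAbs ∧
      p' + q' + r' = 5 * e' ∧ p' * q' * r' = 5 * e' ^ 3 := by
  obtain ⟨⟨t, ht⟩, ⟨w, rfl⟩⟩ :=
    Int.eq_pow_of_mul_eq_pow_odd (IsCoprime.mul_left hpr hqr) (by decide) hm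
  obtain ⟨⟨u, rfl⟩, ⟨v, rfl⟩⟩ := Int.eq_pow_of_mul_eq_pow_odd hpq (by decide) ht
  have heq : u * v * w = e := by
    refine (Odd.strictMono_pow (R := ℤ) (n := 3) (by decide)).injective ?_
    exact Eq.trans (by ring) hm
  subst heq
  have hw : w ≠ 0 := right_ne_zero_of_mul he
  have hu : u ≠ 0 := left_ne_zero_of_mul (left_ne_zero_of_mul he)
  have hv : v ≠ 0 := right_ne_zero_of_mul (left_ne_zero_of_mul he)
  have huw : IsCoprime u w := (IsCoprime.pow_iff (by norm_num) (by norm_num)).1 hpr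
  have hvw : IsCoprime v w := (IsCoprime.pow_iff (by norm_num) (by norm_num)).1 hqr
  have h : u ^ 3 + v ^ 3 + 5 * w ^ 3 = 5 * u * v * w := by rw [hs]; ring
  obtain ⟨b, x, y, hb, hxy⟩ := descent_of_cubic huw hvw hw h
  obtain ⟨p', q', r', h1, h2⟩ := exists_solution_of_descent hxy
  have hb0 : b ≠ 0 := fun h0 => hw (zero_dvd_iff.1 (h0 ▸ hb))
  refine ⟨p', q', r', -b, neg_ne_zero.2 hb0, ?_, h1, h2⟩
  have hle : b.natAbs ≤ w.natAbs :=
    Nat.le_of_dvd (Int.natAbs_pos.2 hw) (Int.natAbs_dvd_natAbs.2 hb)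
  rw [Int.natAbs_neg, Int.natAbs_mul]
  refine lt_of_le_of_lt hle ?_
  have hwpos := Int.natAbs_pos.2 hw
  have huvpos : 0 < (u * v).natAbs := Int.natAbs_pos.2 (mul_ne_zero hu hv)
  suffices (u * v).natAbs ≠ 1 by
    have h2 : 2 ≤ (u * v).natAbs := by omega
    nlinarith
  intro h1
  have hw3 : w * (w ^ 2 + 1) ≠ 0 := mul_ne_zero hw (by positivity)
  rw [Int.natAbs_mul, mul_eq_one, Int.natAbs_eq_iff, Int.natAbs_eq_iff] at h1
  obtain ⟨rfl | rfl, rfl | rfl⟩ := h1 <;> norm_num at h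
  · omega
  · exact hw3 (by linarith)
  · exact hw3 (by linarith)
  · omega

/-- The elliptic curve `(p + q + r) ^ 3 = 25 p q r` has no rational points
off the line `p + q + r = 0`. -/
theorem eq_zero_of_sum_of_prod {p q r e : ℤ} (hs : p + q + r = 5 * e)
    (hm : p * q * r = 5 * e ^ 3) : e = 0 := by
  induction hN : e.natAbs using Nat.strong_induction_on generalizing p q r e with
  | _ N ih =>
  subst hN
  by_contra he
  have hcop : ∀ p q r : ℤ, p + q + r = 5 * e → p * q * r = 5 * e ^ 3 → IsCoprime p q := by
    intro p q r hs hm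
    have hp : p ≠ 0 := by
      rintro rfl
      exact he (by simpa using hm.symm)
    refine isCoprime_of_forall_prime hp fun l hl hlp hlq => ?_
    obtain ⟨p, rfl⟩ := hlp
    obtain ⟨q, rfl⟩ := hlq
    have hle : l ∣ e := by
      have h1 : l ∣ 5 * e ^ 3 := ⟨l * p * q * r, by rw [← hm]; ring⟩
      rcases hl.dvd_or_dvd h1 with h5 | h5
      · have hass : Associated l 5 :=
          hl.associated_of_dvd (Int.prime_iff_natAbs_prime.2 (by norm_num)) h5
        obtain ⟨m, hm5⟩ := hass.symm.dvd
        have : (5 : ℤ) ∣ e ^ 3 := ⟨m ^ 2 * p * q * r, by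
          have : 5 * e ^ 3 = 5 * (5 * (m ^ 2 * p * q * r)) := by rw [← hm, hm5]; ring
          linarith⟩
        exact h5.trans ((Int.prime_iff_natAbs_prime.2 (by norm_num)).dvd_of_dvd_pow this)
      · exact hl.dvd_of_dvd_pow h5
    obtain ⟨e, rfl⟩ := hle
    have hlr : r = l * (5 * e - p - q) := by linarith
    have he' : e ≠ 0 := right_ne_zero_of_mul he
    refine he' (ih e.natAbs ?_ (p := p) (q := q) (r := 5 * e - p - q) (by ring) ?_ rfl)
    · rw [Int.natAbs_mul]
      have h1 : 1 < l.natAbs := (Int.prime_iff_natAbs_prime.1 hl).one_lt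
      have h2 := Int.natAbs_pos.2 he'
      nlinarith
    · have : l ^ 3 * (p * q * (5 * e - p - q)) = l ^ 3 * (5 * e ^ 3) := by
        rw [hlr] at hm; linear_combination hm
      exact mul_left_cancel₀ (pow_ne_zero 3 hl.ne_zero) this
  have main : ∀ p q r : ℤ, p + q + r = 5 * e → p * q * r = 5 * e ^ 3 → ¬ (5 : ℤ) ∣ r := by
    rintro p q r hs hm ⟨r, rfl⟩
    have hpr := hcop p (5 * r) q (by linarith) (by linarith)
    have hqr := hcop q (5 * r) p (by linarith) (by linarith)
    obtain ⟨p', q', r', e', he', hlt, h1, h2⟩ := exists_smaller_solution he hs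
      (by linarith) (hcop p q _ hs hm) hpr.of_mul_right_right hqr.of_mul_right_right
    exact he' (ih _ hlt h1 h2 rfl)
  have h5 : Prime (5 : ℤ) := Int.prime_iff_natAbs_prime.2 (by norm_num)
  rcases h5.dvd_or_dvd (⟨e ^ 3, hm⟩ : (5 : ℤ) ∣ p * q * r) with h | h
  · rcases h5.dvd_or_dvd h with h | h
    · exact main q r p (by linarith) (by linarith) h
    · exact main p r q (by linarith) (by linarith) h
  · exact main p q r hs hm h

/-- The plane cubic obtained by projecting Bring's curve to three coordinates. -/
def bringCubic {R : Type*} [CommRing R] (x y z : R) : R :=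
  (x + y + z) ^ 3 - 2 * (x + y + z) * (x * y + y * z + z * x) + x * y * z

lemma sum_eq_zero_of_bringCubic {x y z : ℚ} (h : bringCubic x y z = 0) : x + y + z = 0 := by
  obtain ⟨n, hn, X, Y, Z, hX, hY, hZ⟩ : ∃ n : ℤ, n ≠ 0 ∧ ∃ X Y Z : ℤ,
      (X : ℚ) = n * x ∧ (Y : ℚ) = n * y ∧ (Z : ℚ) = n * z := by
    refine ⟨x.den * y.den * z.den, by positivity, x.num * y.den * z.den, x.den * y.num * z.den,
      x.den * y.den * z.num, ?_, ?_, ?_⟩ <;> push_cast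
    · linear_combination (-(y.den * z.den : ℚ)) * Rat.mul_den_eq_num x
    · linear_combination (-(x.den * z.den : ℚ)) * Rat.mul_den_eq_num y
    · linear_combination (-(x.den * y.den : ℚ)) * Rat.mul_den_eq_num z
  have hn' : (n : ℚ) ≠ 0 := by exact_mod_cast hn
  have hF : (X + Y + Z) ^ 3 - 2 * (X + Y + Z) * (X * Y + Y * Z + Z * X) + X * Y * Z = 0 := by
    have : ((X : ℚ) + Y + Z) ^ 3 - 2 * (X + Y + Z) * (X * Y + Y * Z + Z * X) + X * Y * Z = 0 := by
      rw [hX, hY, hZ]; unfold bringCubic at h; linear_combination (n : ℚ) ^ 3 * h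
    exact_mod_cast this
  have h0 := eq_zero_of_sum_of_prod (p := 2 * (X + Y + Z) - X) (q := 2 * (X + Y + Z) - Y)
    (r := 2 * (X + Y + Z) - Z) (e := X + Y + Z) (by ring) (by linear_combination -hF)
  have : (n : ℚ) * (x + y + z) = 0 := by
    rw [mul_add, mul_add, ← hX, ← hY, ← hZ]; exact_mod_cast h0
  exact (mul_eq_zero.1 this).resolve_left hn'

lemma bringCubic_of_power_sums {R : Type*} [CommRing R] [NoZeroDivisors R] [CharZero R]
    {x y z s t : R} (h1 : x + y + z + s + t = 0)
    (h2 : x ^ 2 + y ^ 2 + z ^ 2 + s ^ 2 + t ^ 2 = 0)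
    (h3 : x ^ 3 + y ^ 3 + z ^ 3 + s ^ 3 + t ^ 3 = 0) : bringCubic x y z = 0 := by
  have ht : t = -(x + y + z + s) := by linear_combination h1
  subst ht
  have : 6 * bringCubic x y z = 0 := by
    unfold bringCubic
    linear_combination 2 * h3 + 3 * (x + y + z) * h2
  simpa using this

/-- The line through a rational point-pair of conjugate points on the cubic meets the cubic in a
rational point, hence in an intersection of the cubic with the line `x + y + z = 0`. -/
lemma exists_dependency {a₁ a₂ a₃ b₁ b₂ b₃ d : ℚ} {θ : ℂ} (hθ : θ ^ 2 = d)
    (hind : ∀ a b : ℚ, (a : ℂ) + b * θ = 0 → a = 0 ∧ b = 0)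
    (h : bringCubic ((a₁ : ℂ) + b₁ * θ) (a₂ + b₂ * θ) (a₃ + b₃ * θ) = 0) :
    a₁ * (b₂ + b₃) = b₁ * (a₂ + a₃) ∨ a₂ * (b₁ + b₃) = b₂ * (a₁ + a₃) ∨
      a₃ * (b₁ + b₂) = b₃ * (a₁ + a₂) := by
  -- `bringCubic (s a + t b) = A s ^ 3 + B s ^ 2 t + m s t ^ 2 + c t ^ 3`
  set c := bringCubic b₁ b₂ b₃ with hc
  set A := bringCubic a₁ a₂ a₃ with hA
  set P := bringCubic (a₁ + b₁) (a₂ + b₂) (a₃ + b₃) with hP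
  set Q := bringCubic (a₁ - b₁) (a₂ - b₂) (a₃ - b₃) with hQ
  set m := (P + Q) / 2 - A with hm
  set B := (P - Q) / 2 - c with hB
  have hexp : ((A + d * m : ℚ) : ℂ) + ((B + d * c : ℚ) : ℂ) * θ = 0 := by
    rw [hB, hm, hP, hQ, hA, hc]
    rw [← h]
    simp only [bringCubic]
    push_cast
    rw [← hθ]
    ring
  obtain ⟨h1, h2⟩ := hind _ _ hexp
  have hR : bringCubic (a₁ * c - b₁ * m) (a₂ * c - b₂ * m) (a₃ * c - b₃ * m) = 0 := by
    have e : bringCubic (a₁ * c - b₁ * m) (a₂ * c - b₂ * m) (a₃ * c - b₃ * m) =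
        A * c ^ 3 - B * c ^ 2 * m + m * c * m ^ 2 - c * m ^ 3 := by
      have : ∀ s t : ℚ, bringCubic (a₁ * s - b₁ * t) (a₂ * s - b₂ * t) (a₃ * s - b₃ * t) =
        A * s ^ 3 - B * s ^ 2 * t + m * s * t ^ 2 - c * t ^ 3 := by
        intro s t
        rw [hB, hm, hP, hQ, hA, hc]
        simp only [bringCubic]
        ring
      exact this c m
    rw [e]
    linear_combination c ^ 3 * h1 - c ^ 2 * m * h2
  have hsum := sum_eq_zero_of_bringCubic hR
  have hprod : (a₁ * c - b₁ * m) * (a₂ * c - b₂ * m) * (a₃ * c - b₃ * m) = 0 := by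
    have := hR
    rw [bringCubic, hsum] at this
    linarith
  by_cases hcm : c = 0 ∧ m = 0
  · obtain ⟨hc0, hm0⟩ := hcm
    have ha : a₁ + a₂ + a₃ = 0 := sum_eq_zero_of_bringCubic (by rw [← hA]; rw [hm0] at h1; linarith)
    have hb : b₁ + b₂ + b₃ = 0 := sum_eq_zero_of_bringCubic hc0
    left
    linear_combination a₁ * hb - b₁ * ha
  have hdep : ∀ p q : ℚ, p * c - q * m = 0 → ∀ p' q' : ℚ, p' * c - q' * m = 0 →
      p * q' = q * p' := by
    intro p q h p' q' h'
    rcases not_and_or.1 hcm with h0 | h0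
    · refine mul_left_cancel₀ h0 ?_
      linear_combination q' * h - q * h'
    · refine mul_left_cancel₀ h0 ?_
      linear_combination p' * h - p * h'
  rcases mul_eq_zero.1 hprod with h0 | h0
  · rcases mul_eq_zero.1 h0 with h0 | h0
    · exact Or.inl (hdep _ _ h0 _ _ (by linear_combination hsum - h0))
    · exact Or.inr (Or.inl (hdep _ _ h0 _ _ (by linear_combination hsum - h0)))
  · exact Or.inr (Or.inr (hdep _ _ h0 _ _ (by linear_combination hsum - h0)))

lemma not_sq_add_three_mul {a c : ℚ} (ha : a ≠ 0) : a ^ 2 + 3 * a * c + c ^ 2 ≠ 0 := by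
  intro h
  have h5 : IsSquare (5 : ℚ) := ⟨(2 * c + 3 * a) / a, by
    field_simp
    linear_combination (-4) * h⟩
  norm_num at h5

/-- No point of Bring's curve has the shape `(r, α, α', β, β')` with `α, α'` and `β, β'` two pairs
of conjugates unless two of its coordinates add up to zero. -/
lemma false_of_two_conjugate_pairs {a b c f d : ℚ} {θ : ℂ} (hθ : θ ^ 2 = d)
    (hind : ∀ a b : ℚ, (a : ℂ) + b * θ = 0 → a = 0 ∧ b = 0)
    (ha : a ≠ 0) (hc : c ≠ 0) (hb : b ≠ 0) (hf : f ≠ 0)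
    (h24 : ¬ (a + c = 0 ∧ b + f = 0)) (h25 : ¬ (a + c = 0 ∧ b - f = 0))
    (hs2 : (2 * (a + c)) ^ 2 + 2 * a ^ 2 + 2 * c ^ 2 + 2 * d * (b ^ 2 + f ^ 2) = 0)
    (hs3 : -(2 * (a + c)) ^ 3 + 2 * a ^ 3 + 2 * c ^ 3 + 6 * d * (a * b ^ 2 + c * f ^ 2) = 0)
    (h135 : bringCubic (((-2 * (a + c) : ℚ) : ℂ) + (0 : ℚ) * θ) ((a : ℚ) + (-b : ℚ) * θ)
      ((c : ℚ) + (-f : ℚ) * θ) = 0)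
    (h134 : bringCubic (((-2 * (a + c) : ℚ) : ℂ) + (0 : ℚ) * θ) ((a : ℚ) + (-b : ℚ) * θ)
      ((c : ℚ) + (f : ℚ) * θ) = 0) : False := by
  have hac : a + c ≠ 0 := by
    intro h0
    have hc' : c = -a := by linarith
    subst hc'
    have hd : d * (b ^ 2 + f ^ 2) = -2 * a ^ 2 := by linarith
    have hd' : a * (d * ((b + f) * (b - f))) = 0 := by linarith
    have hd0 : d ≠ 0 := by
      rintro rfl
      exact ha (by simpa using hd.symm)
    have := (mul_eq_zero.1 ((mul_eq_zero.1 hd').resolve_left ha)).resolve_left hd0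
    rcases mul_eq_zero.1 this with h | h
    · exact h24 ⟨by ring, h⟩
    · exact h25 ⟨by ring, h⟩
  have hbf : b ^ 2 ≠ f ^ 2 := by
    intro h0
    have : 5 * (a + c) ^ 3 = 0 := by
      rw [← h0] at hs2 hs3
      linear_combination (-1 / 3) * hs3 + (1 / 2) * (a + c) * hs2
    exact hac (by simpa using this)
  have hplus : b + f ≠ 0 := fun h => hbf (by linear_combination (b - f) * h)
  have hminus : b - f ≠ 0 := fun h => hbf (by linear_combination (b + f) * h)
  have hPQ : ∀ f : ℚ, f ≠ 0 → b + f ≠ 0 →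
      bringCubic (((-2 * (a + c) : ℚ) : ℂ) + (0 : ℚ) * θ) ((a : ℚ) + (-b : ℚ) * θ)
      ((c : ℚ) + (-f : ℚ) * θ) = 0 →
      (2 * a + c) * b = -(a * f) ∨ (a + 2 * c) * f = -(c * b) := by
    intro f hf hbf h
    rcases exists_dependency hθ hind h with h | h | h
    · have : (a + c) * (b + f) = 0 := by linear_combination (1 / 2) * h
      exact ((mul_ne_zero hac hbf) this).elim
    · left; linear_combination -h
    · right; linear_combination -h
  have hcf := not_sq_add_three_mul (c := c) ha
  rcases hPQ f hf hplus h135 with h | h <;>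
    rcases hPQ (-f) (neg_ne_zero.2 hf) (by simpa [sub_eq_add_neg] using hminus)
      (by simpa using h134) with h' | h'
  · exact mul_ne_zero ha hf (by linarith)
  · have : 2 * b * f * (a ^ 2 + 3 * a * c + c ^ 2) = 0 := by
      linear_combination (a + 2 * c) * f * h + a * f * h'
    exact mul_ne_zero (mul_ne_zero (mul_ne_zero two_ne_zero hb) hf) hcf this
  · have : 2 * b * f * (a ^ 2 + 3 * a * c + c ^ 2) = 0 := by
      linear_combination (2 * a + c) * b * h - c * b * h'
    exact mul_ne_zero (mul_ne_zero (mul_ne_zero two_ne_zero hb) hf) hcf this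
  · exact mul_ne_zero hc hb (by linarith)

lemma exists_rat_mul_eq {p q p' q' : ℚ} {θ : ℂ} (h : p * q' = q * p')
    (h0 : (p' : ℂ) + q' * θ ≠ 0) : ∃ α : ℚ, (p : ℂ) + q * θ = α * (p' + q' * θ) := by
  have hC : (p : ℂ) * q' = q * p' := by exact_mod_cast h
  by_cases hp : p' = 0
  · have hq : (q' : ℂ) ≠ 0 := by
      intro hq
      exact h0 (by rw [hp, hq]; simp)
    refine ⟨q / q', ?_⟩
    push_cast
    field_simp
    linear_combination hC
  · have hp' : (p' : ℂ) ≠ 0 := by exact_mod_cast hp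
    refine ⟨p / p', ?_⟩
    push_cast
    field_simp
    linear_combination (-θ) * hC

/-- The normalised case: the first coordinate and the sum of the next two are rational. -/
lemma false_of_normalised {α a b c f d : ℚ} {θ : ℂ} {y : Fin 5 → ℂ} (hθ : θ ^ 2 = d)
    (hind : ∀ a b : ℚ, (a : ℂ) + b * θ = 0 → a = 0 ∧ b = 0)
    (h1 : ∑ i, y i = 0) (h2 : ∑ i, y i ^ 2 = 0) (h3 : ∑ i, y i ^ 3 = 0)
    (hpair : ∀ i j, i ≠ j → y i + y j ≠ 0)
    (h0 : y 0 = α) (h12 : y 1 + y 2 = 1) (hy1 : y 1 = a + b * θ) (hy3 : y 3 = c + f * θ) :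
    False := by
  simp only [Fin.sum_univ_five] at h1 h2 h3
  have hF : ∀ i j k l m : Fin 5, y i + y j + y k + y l + y m = y 0 + y 1 + y 2 + y 3 + y 4 →
      y i ^ 2 + y j ^ 2 + y k ^ 2 + y l ^ 2 + y m ^ 2 =
        y 0 ^ 2 + y 1 ^ 2 + y 2 ^ 2 + y 3 ^ 2 + y 4 ^ 2 →
      y i ^ 3 + y j ^ 3 + y k ^ 3 + y l ^ 3 + y m ^ 3 =
        y 0 ^ 3 + y 1 ^ 3 + y 2 ^ 3 + y 3 ^ 3 + y 4 ^ 3 →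
      bringCubic (y i) (y j) (y k) = 0 := fun i j k l m e1 e2 e3 =>
    bringCubic_of_power_sums (e1.trans h1) (e2.trans h2) (e3.trans h3)
  have hy2 : y 2 = ((1 - a : ℚ) : ℂ) + ((-b : ℚ) : ℂ) * θ := by
    push_cast; linear_combination h12 - hy1
  have hy4 : y 4 = ((-1 - α - c : ℚ) : ℂ) + ((-f : ℚ) : ℂ) * θ := by
    push_cast; linear_combination h1 - h12 - h0 - hy3
  have hb : b ≠ 0 := by
    rintro rfl
    have := hF 0 1 2 3 4 rfl rfl rfl
    rw [h0, hy1, hy2] at this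
    have hr : bringCubic α a (1 - a) = 0 := by
      simp only [bringCubic] at this ⊢
      have h' : ((((α + a + (1 - a)) ^ 3 - 2 * (α + a + (1 - a)) *
        (α * a + a * (1 - a) + (1 - a) * α) + α * a * (1 - a) : ℚ)) : ℂ) = 0 := by
        push_cast; push_cast at this; linear_combination this
      exact_mod_cast h'
    have hs := sum_eq_zero_of_bringCubic hr
    have hs' : (α : ℂ) + a + (1 - a) = 0 := by exact_mod_cast hs
    exact hpair 3 4 (by decide) (by linear_combination h1 - h12 - h0 - hs')
  have hf : f ≠ 0 := by
    rintro rfl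
    have := hF 0 3 4 1 2 (by ring) (by ring) (by ring)
    rw [h0, hy3, hy4] at this
    have hr : bringCubic α c (-1 - α - c) = 0 := by
      simp only [bringCubic] at this ⊢
      have h' : ((((α + c + (-1 - α - c)) ^ 3 - 2 * (α + c + (-1 - α - c)) *
        (α * c + c * (-1 - α - c) + (-1 - α - c) * α) + α * c * (-1 - α - c) : ℚ)) : ℂ) = 0 := by
        push_cast; push_cast at this; linear_combination this
      exact_mod_cast h'
    have hs := sum_eq_zero_of_bringCubic hr
    linarith
  have hα : -1 - α ≠ 0 := by
    intro h
    have h' : (-1 : ℂ) - α = 0 := by exact_mod_cast h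
    exact hpair 3 4 (by decide) (by linear_combination h1 - h12 - h0 + h')
  have e2 : ((α ^ 2 + a ^ 2 + (1 - a) ^ 2 + c ^ 2 + (-1 - α - c) ^ 2 + 2 * d * (b ^ 2 + f ^ 2) : ℚ) : ℂ)
      + ((2 * b * (a - (1 - a)) + 2 * f * (c - (-1 - α - c)) : ℚ) : ℂ) * θ = 0 := by
    rw [h0, hy1, hy2, hy3, hy4] at h2
    push_cast at h2 ⊢
    linear_combination h2 - 2 * ((b : ℂ) ^ 2 + f ^ 2) * hθ
  have e3 : ((α ^ 3 + a ^ 3 + (1 - a) ^ 3 + c ^ 3 + (-1 - α - c) ^ 3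
      + 3 * d * (b ^ 2 + f ^ 2 * (-1 - α)) : ℚ) : ℂ)
      + ((3 * b * (a ^ 2 - (1 - a) ^ 2) + 3 * f * (c ^ 2 - (-1 - α - c) ^ 2) : ℚ) : ℂ) * θ = 0 := by
    rw [h0, hy1, hy2, hy3, hy4] at h3
    push_cast at h3 ⊢
    linear_combination h3 - 3 * ((b : ℂ) ^ 2 + f ^ 2 * (-1 - α)) * hθ
  obtain ⟨r2, i2⟩ := hind _ _ e2
  obtain ⟨r3, i3⟩ := hind _ _ e3
  have hα2 : -1 - α ≠ 1 := by
    intro h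
    have hα : α = -2 := by linarith
    subst hα
    have : (5 : ℚ) = 0 := by linear_combination (-1 / 3) * r3 + (1 / 2) * r2
    norm_num at this
  have hfc : f * (c - (-1 - α - c)) * (-1 - α - 1) = 0 := by
    linear_combination (1 / 3) * i3 - (1 / 2) * i2
  have hcc : c - (-1 - α - c) = 0 :=
    (mul_eq_zero.1 ((mul_eq_zero.1 hfc).resolve_right (sub_ne_zero.2 hα2))).resolve_left hf
  have haa : a - (1 - a) = 0 := by
    rw [hcc] at i2
    have : b * (a - (1 - a)) = 0 := by linarith
    exact (mul_eq_zero.1 this).resolve_left hb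
  have ha : a = 1 / 2 := by linarith
  have hαc : α = -2 * (a + c) := by linarith
  have h4c : -1 - α - c = c := by linarith
  have h2a : 1 - a = a := by linarith
  have hc : c ≠ 0 := by
    rintro rfl
    exact hα (by linarith)
  rw [h2a] at hy2
  rw [h4c] at hy4
  have h0' : y 0 = ((-2 * (a + c) : ℚ) : ℂ) + (0 : ℚ) * θ := by rw [h0, hαc]; simp
  have h135 := hF 0 2 4 1 3 (by ring) (by ring) (by ring)
  have h134 := hF 0 2 3 1 4 (by ring) (by ring) (by ring)
  rw [h0', hy2, hy4] at h135
  rw [h0', hy2, hy3] at h134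
  refine false_of_two_conjugate_pairs hθ hind (by rw [ha]; norm_num) hc hb hf ?_ ?_ ?_ ?_ h135 h134
  · rintro ⟨hac, hbf⟩
    refine hpair 1 3 (by decide) ?_
    have hac' : (a : ℂ) + c = 0 := by exact_mod_cast hac
    have hbf' : (b : ℂ) + f = 0 := by exact_mod_cast hbf
    linear_combination hy1 + hy3 + hac' + θ * hbf'
  · rintro ⟨hac, hbf⟩
    refine hpair 1 4 (by decide) ?_
    have hac' : (a : ℂ) + c = 0 := by exact_mod_cast hac
    have hbf' : (b : ℂ) - f = 0 := by exact_mod_cast hbf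
    push_cast at hy4
    linear_combination hy1 + hy4 + hac' + θ * hbf'
  · rw [h4c, h2a, hαc] at r2
    linear_combination r2
  · rw [h4c, h2a] at r3
    have h1a : (-1 - α) = 2 * c := by linarith
    rw [h1a, hαc] at r3
    linear_combination r3 + 6 * d * b ^ 2 * ha

lemma eq_zero_of_add_mul_eq_zero {θ : ℂ} (hθ : ∀ q : ℚ, (q : ℂ) ≠ θ) (a b : ℚ)
    (h : (a : ℂ) + b * θ = 0) : a = 0 ∧ b = 0 := by
  have hb : b = 0 := by
    by_contra hb
    have hb' : (b : ℂ) ≠ 0 := by exact_mod_cast hb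
    refine hθ (-a / b) ?_
    push_cast
    field_simp
    linear_combination -h
  subst hb
  simpa using h

lemma ratCast_ne_I (q : ℚ) : (q : ℂ) ≠ I := by
  intro h
  simpa using congrArg Complex.im h

/-- An extension of `ℚ` of degree at most two inside `ℂ` is contained in `ℚ + ℚθ` for some
irrational square root `θ` of a rational number. -/
lemma exists_sqrt_generator (K : IntermediateField ℚ ℂ) [FiniteDimensional ℚ K]
    (hK : Module.finrank ℚ K ≤ 2) :
    ∃ (d : ℚ) (θ : ℂ), θ ^ 2 = d ∧ (∀ q : ℚ, (q : ℂ) ≠ θ) ∧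
      ∀ z ∈ K, ∃ a b : ℚ, z = a + b * θ := by
  by_cases hQ : ∀ z ∈ K, ∃ q : ℚ, (q : ℂ) = z
  · refine ⟨-1, I, by simp, ratCast_ne_I, fun z hz => ?_⟩
    obtain ⟨q, rfl⟩ := hQ z hz
    exact ⟨q, 0, by simp⟩
  push Not at hQ
  obtain ⟨w, hw, hwQ⟩ := hQ
  have hli : LinearIndependent ℚ ![(1 : K), ⟨w, hw⟩] := by
    rw [LinearIndependent.pair_iff]
    intro s t hst
    refine eq_zero_of_add_mul_eq_zero hwQ s t ?_
    have := congrArg (Subtype.val : K → ℂ) hst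
    simpa [Algebra.smul_def] using this
  have hspan := hli.span_eq_top_of_card_eq_finrank (by
    have := hli.fintype_card_le_finrank
    simp only [Fintype.card_fin] at this ⊢
    omega)
  have hrep : ∀ z ∈ K, ∃ a b : ℚ, z = a + b * w := by
    intro z hz
    have hz' : (⟨z, hz⟩ : K) ∈ Submodule.span ℚ (Set.range ![(1 : K), ⟨w, hw⟩]) := by
      rw [hspan]; trivial
    rw [Matrix.range_cons, Matrix.range_cons, Matrix.range_empty, Set.union_empty,
      Set.singleton_union, Submodule.mem_span_pair] at hz'
    obtain ⟨a, b, hab⟩ := hz'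
    have := congrArg (Subtype.val : K → ℂ) hab
    exact ⟨a, b, by simpa [Algebra.smul_def] using this.symm⟩
  obtain ⟨m, n, hmn⟩ := hrep (w ^ 2) (pow_mem hw 2)
  refine ⟨m + n ^ 2 / 4, w - n / 2, ?_, fun q hq => hwQ (q + n / 2) ?_, fun z hz => ?_⟩
  · push_cast
    linear_combination hmn
  · push_cast
    linear_combination hq
  · obtain ⟨a, b, rfl⟩ := hrep z hz
    exact ⟨a + b * n / 2, b, by push_cast; ring⟩

/-- If the first coordinate is a rational multiple of the sum of the next two, rescaling reduces
to the normalised case. -/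
lemma false_of_rat_multiple (K : IntermediateField ℚ ℂ) {d : ℚ} {θ : ℂ} (hθ : θ ^ 2 = d)
    (hind : ∀ a b : ℚ, (a : ℂ) + b * θ = 0 → a = 0 ∧ b = 0)
    (hrep : ∀ z ∈ K, ∃ a b : ℚ, z = a + b * θ) {x : Fin 5 → ℂ} (hmem : ∀ i, x i ∈ K)
    (h1 : ∑ i, x i = 0) (h2 : ∑ i, x i ^ 2 = 0) (h3 : ∑ i, x i ^ 3 = 0)
    (hpair : ∀ i j, i ≠ j → x i + x j ≠ 0) {α : ℚ} (h0 : x 0 = α * (x 1 + x 2)) : False := by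
  have hs : x 1 + x 2 ≠ 0 := hpair 1 2 (by decide)
  have hsK : x 1 + x 2 ∈ K := add_mem (hmem 1) (hmem 2)
  obtain ⟨a, b, hab⟩ := hrep _ (div_mem (hmem 1) hsK)
  obtain ⟨c, f, hcf⟩ := hrep _ (div_mem (hmem 3) hsK)
  refine false_of_normalised (y := fun i => x i / (x 1 + x 2)) hθ hind ?_ ?_ ?_
    (fun i j hij => ?_) (α := α) ?_ ?_ hab hcf
  · rw [← Finset.sum_div, h1, zero_div]
  · simp only [div_pow]
    rw [← Finset.sum_div, h2, zero_div]
  · simp only [div_pow]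
    rw [← Finset.sum_div, h3, zero_div]
  · simp only [← add_div]
    exact div_ne_zero (hpair i j hij) hs
  · exact (div_eq_iff hs).2 h0
  · simp only [← add_div]
    exact div_self hs

lemma exists_pair_add_eq_zero (K : IntermediateField ℚ ℂ) [FiniteDimensional ℚ K]
    (hK : Module.finrank ℚ K ≤ 2) {x : Fin 5 → ℂ} (hmem : ∀ i, x i ∈ K)
    (h1 : ∑ i, x i = 0) (h2 : ∑ i, x i ^ 2 = 0) (h3 : ∑ i, x i ^ 3 = 0) :
    ∃ i j, i ≠ j ∧ x i + x j = 0 := by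
  by_contra! hpair
  obtain ⟨d, θ, hθ, hirr, hrep⟩ := exists_sqrt_generator K hK
  have hind := eq_zero_of_add_mul_eq_zero hirr
  have key : ∀ (σ : Equiv.Perm (Fin 5)) (α : ℚ), x (σ 0) ≠ α * (x (σ 1) + x (σ 2)) :=
    fun σ α h => false_of_rat_multiple K (x := fun i => x (σ i)) hθ hind hrep
      (fun i => hmem _) ((Equiv.sum_comp σ x).trans h1)
      ((Equiv.sum_comp σ fun i => x i ^ 2).trans h2)
      ((Equiv.sum_comp σ fun i => x i ^ 3).trans h3)
      (fun i j hij => hpair _ _ (σ.injective.ne hij)) h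
  have hC : bringCubic (x 0) (x 1) (x 2) = 0 := by
    rw [Fin.sum_univ_five] at h1 h2 h3
    exact bringCubic_of_power_sums h1 h2 h3
  obtain ⟨a₁, b₁, e₁⟩ := hrep _ (hmem 0)
  obtain ⟨a₂, b₂, e₂⟩ := hrep _ (hmem 1)
  obtain ⟨a₃, b₃, e₃⟩ := hrep _ (hmem 2)
  have step : ∀ (i j k : Fin 5) (a b a' b' a'' b'' : ℚ), j ≠ k → x i = a + b * θ →
      x j = a' + b' * θ → x k = a'' + b'' * θ → a * (b' + b'') = b * (a' + a'') →
      ∃ α : ℚ, x i = α * (x j + x k) := by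
    intro i j k a b a' b' a'' b'' hjk hi hj hk h
    have hsum : x j + x k = ((a' + a'' : ℚ) : ℂ) + (b' + b'' : ℚ) * θ := by
      rw [hj, hk]; push_cast; ring
    obtain ⟨α, hα⟩ := exists_rat_mul_eq (θ := θ) h (hsum ▸ hpair j k hjk)
    exact ⟨α, by rw [hi, hα, hsum]⟩
  rw [e₁, e₂, e₃] at hC
  rcases exists_dependency hθ hind hC with h | h | h
  · obtain ⟨α, hα⟩ := step 0 1 2 _ _ _ _ _ _ (by decide) e₁ e₂ e₃ h
    exact key 1 α hα
  · obtain ⟨α, hα⟩ := step 1 0 2 _ _ _ _ _ _ (by decide) e₂ e₁ e₃ h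
    exact key (Equiv.swap 0 1) α hα
  · obtain ⟨α, hα⟩ := step 2 0 1 _ _ _ _ _ _ (by decide) e₃ e₁ e₂ h
    refine key (Equiv.swap 0 2) α ?_
    rw [show Equiv.swap (0 : Fin 5) 2 0 = 2 by decide, show Equiv.swap (0 : Fin 5) 2 1 = 1 by decide,
      show Equiv.swap (0 : Fin 5) 2 2 = 0 by decide, hα, add_comm (x 0)]

/-- A tuple with two opposite coordinates has, after a permutation, the shape
`(u, v, -u, -v, 0)` with `u² + v² = 0`. -/
lemma exists_perm_of_pair {x : Fin 5 → ℂ} (h1 : ∑ i, x i = 0) (h2 : ∑ i, x i ^ 2 = 0)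
    (h3 : ∑ i, x i ^ 3 = 0) {i j : Fin 5} (hij : i ≠ j) (h : x i + x j = 0) :
    ∃ σ : Equiv.Perm (Fin 5), x (σ 2) = -x (σ 0) ∧ x (σ 3) = -x (σ 1) ∧ x (σ 4) = 0 ∧
      x (σ 0) ^ 2 + x (σ 1) ^ 2 = 0 := by
  obtain ⟨σ, rfl, rfl⟩ : ∃ σ : Equiv.Perm (Fin 5), σ 0 = i ∧ σ 2 = j := by
    refine ⟨Equiv.swap 0 i * Equiv.swap 2 (Equiv.swap 0 i j), ?_, ?_⟩
    · have hne : (0 : Fin 5) ≠ Equiv.swap 0 i j := by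
        intro h'
        exact hij (by simpa using congrArg (Equiv.swap 0 i) h')
      rw [Equiv.Perm.mul_apply, Equiv.swap_apply_of_ne_of_ne (by decide) hne,
        Equiv.swap_apply_left]
    · rw [Equiv.Perm.mul_apply, Equiv.swap_apply_left, Equiv.swap_apply_self]
  have s1 := (Equiv.sum_comp σ x).trans h1
  have s2 := (Equiv.sum_comp σ fun i => x i ^ 2).trans h2
  have s3 := (Equiv.sum_comp σ fun i => x i ^ 3).trans h3
  simp only [Fin.sum_univ_five] at s1 s2 s3
  have e2 : x (σ 2) = -x (σ 0) := by linear_combination h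
  rw [e2] at s1 s2 s3
  have hprod : x (σ 1) * x (σ 3) * x (σ 4) = 0 := by
    have e4 : x (σ 4) = -x (σ 1) - x (σ 3) := by linear_combination s1
    rw [e4] at s3 ⊢
    linear_combination (1 / 3) * s3
  have finish : ∀ τ : Equiv.Perm (Fin 5), τ 0 = 0 → τ 2 = 2 → x (σ (τ 4)) = 0 →
      x (σ (τ 3)) = -x (σ (τ 1)) → x (σ 0) ^ 2 + x (σ (τ 1)) ^ 2 = 0 →
      ∃ σ : Equiv.Perm (Fin 5), x (σ 2) = -x (σ 0) ∧ x (σ 3) = -x (σ 1) ∧ x (σ 4) = 0 ∧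
        x (σ 0) ^ 2 + x (σ 1) ^ 2 = 0 := by
    intro τ t0 t2 h4 h3' hsq
    refine ⟨σ * τ, ?_, h3', h4, ?_⟩
    · simpa only [Equiv.Perm.mul_apply, t0, t2] using e2
    · simpa only [Equiv.Perm.mul_apply, t0] using hsq
  rcases mul_eq_zero.1 hprod with h13 | h4
  · rcases mul_eq_zero.1 h13 with hz | hz
    · have e : x (σ 3) = -x (σ 4) := by linear_combination s1 - hz
      refine finish (Equiv.swap 1 4) (by decide) (by decide) hz e ?_
      rw [hz, e] at s2
      change x (σ 0) ^ 2 + x (σ 4) ^ 2 = 0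
      linear_combination (1 / 2) * s2
    · have e : x (σ 4) = -x (σ 1) := by linear_combination s1 - hz
      refine finish (Equiv.swap 3 4) (by decide) (by decide) hz e ?_
      rw [hz, e] at s2
      change x (σ 0) ^ 2 + x (σ 1) ^ 2 = 0
      linear_combination (1 / 2) * s2
  · have e : x (σ 3) = -x (σ 1) := by linear_combination s1 - h4
    refine finish 1 rfl rfl h4 e ?_
    rw [h4, e] at s2
    change x (σ 0) ^ 2 + x (σ 1) ^ 2 = 0
    linear_combination (1 / 2) * s2

lemma eq_adjoin_I (K : IntermediateField ℚ ℂ) [FiniteDimensional ℚ K]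
    (hK : Module.finrank ℚ K ≤ 2) (hI : I ∈ K) : K = IntermediateField.adjoin ℚ {I} := by
  refine (IntermediateField.eq_of_le_of_finrank_le
    (IntermediateField.adjoin_simple_le_iff.2 hI) (hK.trans ?_)).symm
  have : FiniteDimensional ℚ (IntermediateField.adjoin ℚ {I}) :=
    IntermediateField.finiteDimensional_adjoin fun z hz => by
      rw [Set.mem_singleton_iff.1 hz]
      exact ⟨Polynomial.X ^ 2 + 1, by monicity!, by simp⟩
  have hne : Module.finrank ℚ (IntermediateField.adjoin ℚ {I}) ≠ 1 := by
    rw [Ne, IntermediateField.finrank_adjoin_simple_eq_one_iff, IntermediateField.mem_bot]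
    rintro ⟨q, hq⟩
    exact ratCast_ne_I q (by simpa using hq)
  have := Module.finrank_pos (R := ℚ) (M := IntermediateField.adjoin ℚ {I})
  omega

/-- **Dogra**: all quadratic points of Bring's curve are defined over `ℚ(i)`, and up to
permutation of the coordinates and scaling they are the points `(1 : ±i : -1 : ∓i : 0)`.
Precisely: if `K ⊆ ℂ` with `[K : ℚ] ≤ 2` and `(x₁, …, x₅) ∈ K⁵` is a nonzero tuple with
`∑ xᵢ = ∑ xᵢ² = ∑ xᵢ³ = 0`, then `K = ℚ(i)` and some permutation of the tuple is a nonzero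
scalar multiple of `(1, i, -1, -i, 0)` or `(1, -i, -1, i, 0)`. -/
theorem quadratic_points_brings_curve (K : IntermediateField ℚ ℂ)
    [FiniteDimensional ℚ K] (hK : Module.finrank ℚ K ≤ 2)
    (x : Fin 5 → ℂ) (hmem : ∀ i, x i ∈ K) (hne : x ≠ 0)
    (h1 : ∑ i, x i = 0) (h2 : ∑ i, x i ^ 2 = 0) (h3 : ∑ i, x i ^ 3 = 0) :
    K = IntermediateField.adjoin ℚ {Complex.I} ∧
    ∃ l : ℂ, l ∈ K ∧ l ≠ 0 ∧ ∃ σ : Equiv.Perm (Fin 5),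
      ((fun i => x (σ i)) = fun i => l * ![1, I, -1, -I, 0] i) ∨
      ((fun i => x (σ i)) = fun i => l * ![1, -I, -1, I, 0] i) := by
  obtain ⟨i, j, hij, hsum⟩ := exists_pair_add_eq_zero K hK hmem h1 h2 h3
  obtain ⟨σ, e2, e3, e4, hsq⟩ := exists_perm_of_pair h1 h2 h3 hij hsum
  have h0 : x (σ 0) ≠ 0 := by
    intro h0
    have h1' : x (σ 1) = 0 := by simpa [h0] using hsq
    have hall : ∀ k, x (σ k) = 0 := by
      intro k
      fin_cases k <;> simp [h0, h1', e2, e3, e4]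
    exact hne (funext fun k => by simpa using hall (σ.symm k))
  have hroot : x (σ 1) = x (σ 0) * I ∨ x (σ 1) = x (σ 0) * -I := by
    have : (x (σ 1) - x (σ 0) * I) * (x (σ 1) - x (σ 0) * -I) = 0 := by
      linear_combination hsq - x (σ 0) ^ 2 * I_sq
    exact (mul_eq_zero.1 this).imp sub_eq_zero.1 sub_eq_zero.1
  have hdiv : x (σ 1) / x (σ 0) ∈ K := div_mem (hmem _) (hmem _)
  have hI : I ∈ K := by
    rcases hroot with h | h
    · rwa [h, mul_div_cancel_left₀ _ h0] at hdiv
    · rw [h, mul_div_cancel_left₀ _ h0] at hdiv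
      simpa using neg_mem hdiv
  refine ⟨eq_adjoin_I K hK hI, x (σ 0), hmem _, h0, σ, ?_⟩
  refine hroot.imp (fun h => ?_) (fun h => ?_) <;>
  · funext k
    fin_cases k <;> simp [h, e2, e3, e4]
end

section
/- Let K be a field of characteristic zero and let x, y ∈ K satisfy x³ + y³ + 1 + x²y + y²x + x² + y² + xy + x + y = 0 and 1 + 2x + 2y ≠ 0. Set u = 2/(1 + 2x + 2y) and v = 4(y − x)/(1 + 2x + 2y). Then v² + 5u³ + 5u² + 4 = 0. (This is the change of variables exhibiting the plane cubic E′ as isomorphic to the elliptic curve 50.a3.) -/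
/-- The change of variables `u = 2/(1 + 2x + 2y)`, `v = 4(y - x)/(1 + 2x + 2y)` carries the
plane cubic `E' : x³ + y³ + 1 + x²y + y²x + x² + y² + xy + x + y = 0` (the quotient of Bring's
curve by a transposition of coordinates) to the elliptic curve `v² + 5u³ + 5u² + 4 = 0`
(LMFDB label 50.a3). -/
theorem brings_quotient_to_50a3 (K : Type) [Field K] [CharZero K] (x y : K)
    (h : x ^ 3 + y ^ 3 + 1 + x ^ 2 * y + y ^ 2 * x + x ^ 2 + y ^ 2 + x * y + x + y = 0)
    (hd : 1 + 2 * x + 2 * y ≠ 0) :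
    (4 * (y - x) / (1 + 2 * x + 2 * y)) ^ 2 + 5 * (2 / (1 + 2 * x + 2 * y)) ^ 3
      + 5 * (2 / (1 + 2 * x + 2 * y)) ^ 2 + 4 = 0 := by
  have key : 16 * (y - x) ^ 2 * (1 + 2 * x + 2 * y) + 40 + 20 * (1 + 2 * x + 2 * y)
      + 4 * (1 + 2 * x + 2 * y) ^ 3 = 0 := by
    linear_combination 64 * h
  generalize 1 + 2 * x + 2 * y = d at hd key ⊢
  field_simp
  linear_combination key
end
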